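/- Let ℓ be a positive integer and ε > 0. There exists a constant C = C(ε,ℓ) > 0 such that for every squarefree integer a > 1 the pure cubic field K = ℚ(a^{1/3}) satisfies #Cl_K[ℓ] ≤ C · D_K^{1/2 − 1/(3ℓ) + ε}. -/

import Mathlib

open NumberField Polynomial

/-- The denominator ideal of `α ∈ K`: the set of `x ∈ 𝓞 K` with `x·α ∈ 𝓞 K`.
Its absolute norm is the non-archimedean part `∏_v max(1,|α|_v)^{d_v}` of the height. -/
noncomputable def denIdeal (K : Type*) [Field K] [NumberField K] (α : K) : Ideal (𝓞 K) where
  carrier := {x : 𝓞 K | ∃ y : 𝓞 K, (x : K) * α = (y : K)}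
  zero_mem' := ⟨0, by simp⟩
  add_mem' := by
    rintro a b ⟨ya, ha⟩ ⟨yb, hb⟩
    exact ⟨ya + yb, by push_cast; rw [add_mul, ha, hb]⟩
  smul_mem' := by
    rintro c x ⟨y, hy⟩
    exact ⟨c * y, by rw [smul_eq_mul]; push_cast; rw [mul_assoc, hy]⟩

/-- The relative multiplicative Weil height `H_K(α) = ∏_{v ∈ M_K} max(1,|α|_v)^{d_v}`. -/
noncomputable def heightK (K : Type*) [Field K] [NumberField K] (α : K) : ℝ :=
  (Ideal.absNorm (denIdeal K α) : ℝ) * ∏ w : InfinitePlace K, max 1 (w α) ^ w.mult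

/-- `N'_K(X)`: the number of `α ∈ K` with `ℚ(α) = K` and `H_K(α) < X`. -/
noncomputable def NprimeK (K : Type*) [Field K] [NumberField K] (X : ℝ) : ℕ :=
  Nat.card {α : K // IntermediateField.adjoin ℚ {α} = ⊤ ∧ heightK K α < X}

/-- `M_{K,ℓ} = inf_{X > 0} X^{-1/ℓ}(1 + N'_K(X))`. -/
noncomputable def MKl (K : Type*) [Field K] [NumberField K] (ℓ : ℕ) : ℝ :=
  ⨅ X : {X : ℝ // 0 < X}, (X : ℝ) ^ (-(1:ℝ)/ℓ) * (1 + (NprimeK K X : ℝ))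

/-- `η(K)`: the minimal height of a primitive element of `K`. -/
noncomputable def etaK (K : Type*) [Field K] [NumberField K] : ℝ :=
  sInf {x : ℝ | ∃ α : K, IntermediateField.adjoin ℚ {α} = ⊤ ∧ heightK K α = x}

/-- `D_K`: the absolute value of the discriminant. -/
noncomputable def DK (K : Type*) [Field K] [NumberField K] : ℕ :=
  (NumberField.discr K).natAbs

section PrimesTwoModThree

open Finset ArithmeticFunction

/-- The nontrivial Dirichlet character modulo `3`, as a real arithmetic function. -/
noncomputable def chiThree : ArithmeticFunction ℝ :=
  ⟨fun n => if n % 3 = 1 then 1 else if n % 3 = 2 then -1 else 0, by simp⟩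

theorem chiThree_apply (n : ℕ) :
    chiThree n = if n % 3 = 1 then 1 else if n % 3 = 2 then -1 else 0 := rfl

theorem chiThree_mul (m n : ℕ) : chiThree (m * n) = chiThree m * chiThree n := by
  have hm : m % 3 < 3 := Nat.mod_lt _ (by norm_num)
  have hn : n % 3 < 3 := Nat.mod_lt _ (by norm_num)
  simp only [chiThree_apply, Nat.mul_mod m n]
  interval_cases m % 3 <;> interval_cases n % 3 <;> norm_num

theorem sum_Ioc_chiThree (N : ℕ) :
    ∑ n ∈ Ioc 0 N, chiThree n = if N % 3 = 1 then 1 else 0 := by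
  induction N with
  | zero => simp
  | succ N ih =>
    rw [Finset.sum_Ioc_succ_top (Nat.zero_le N), ih, chiThree_apply]
    have hN : N % 3 < 3 := Nat.mod_lt _ (by norm_num)
    rw [Nat.add_mod]
    interval_cases N % 3 <;> norm_num

theorem sum_Ioc_chiThree_mul_log_le (N : ℕ) :
    ∑ n ∈ Ioc 0 N, chiThree n * Real.log n ≤ Real.log N := by
  have key : ∀ k : ℕ, ∑ n ∈ Ioc 0 (3 * k), chiThree n * Real.log n ≤ 0 := by
    intro k
    induction k with
    | zero => simp
    | succ k ih =>
      rw [show 3 * (k + 1) = 3 * k + 1 + 1 + 1 by ring, Finset.sum_Ioc_succ_top (Nat.zero_le _),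
        Finset.sum_Ioc_succ_top (Nat.zero_le _), Finset.sum_Ioc_succ_top (Nat.zero_le _)]
      have h : Real.log ((3 * k + 1 : ℕ) : ℝ) ≤ Real.log ((3 * k + 1 + 1 : ℕ) : ℝ) :=
        Real.log_le_log (by positivity) (by push_cast; linarith)
      rw [chiThree_apply (3 * k + 1), chiThree_apply (3 * k + 1 + 1),
        chiThree_apply (3 * k + 1 + 1 + 1), if_pos (by omega), if_neg (by omega),
        if_pos (by omega), if_neg (by omega), if_neg (by omega)]
      linarith
  obtain ⟨k, hk | hk | hk⟩ : ∃ k, N = 3 * k ∨ N = 3 * k + 1 ∨ N = 3 * k + 1 + 1 :=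
    ⟨N / 3, by omega⟩
  · rw [hk]
    exact (key k).trans (Real.log_natCast_nonneg _)
  · rw [hk, Finset.sum_Ioc_succ_top (Nat.zero_le _), chiThree_apply (3 * k + 1),
      if_pos (by omega)]
    linarith [key k]
  · rw [hk, Finset.sum_Ioc_succ_top (Nat.zero_le _), Finset.sum_Ioc_succ_top (Nat.zero_le _),
      chiThree_apply (3 * k + 1), chiThree_apply (3 * k + 1 + 1),
      if_pos (by omega), if_neg (by omega), if_pos (by omega)]
    have h : Real.log ((3 * k + 1 : ℕ) : ℝ) ≤ Real.log ((3 * k + 1 + 1 : ℕ) : ℝ) :=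
        Real.log_le_log (by positivity) (by push_cast; linarith)
    linarith [key k, Real.log_natCast_nonneg (3 * k + 1 + 1)]

theorem sum_Ioc_chiThree_mul_vonMangoldt (N : ℕ) :
    ∑ n ∈ Ioc 0 N, chiThree n * vonMangoldt n * (if (N / n) % 3 = 1 then 1 else 0) =
      ∑ n ∈ Ioc 0 N, chiThree n * Real.log n := by
  have h := sum_Ioc_mul_eq_sum_sum (pmul chiThree vonMangoldt) chiThree N
  simp only [sum_Ioc_chiThree, pmul_apply] at h
  rw [← h]
  refine Finset.sum_congr rfl fun n hn => ?_
  rw [ArithmeticFunction.mul_apply, ← vonMangoldt_sum, Finset.mul_sum,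
    Nat.sum_divisorsAntidiagonal
      (fun d e => pmul chiThree vonMangoldt d * chiThree e)]
  refine Finset.sum_congr rfl fun d hd => ?_
  have hd' : d * (n / d) = n := Nat.mul_div_cancel' (Nat.dvd_of_mem_divisors hd)
  rw [pmul_apply]
  conv_rhs => rw [← hd', chiThree_mul]
  ring

/-- The primes `p ≤ N` with `p ≡ 2 mod 3`. -/
def primesTwoModThree (N : ℕ) : Finset ℕ := {p ∈ Ioc 0 N | p.Prime ∧ p % 3 = 2}

theorem theta_sub_theta_half_le {N : ℕ} (hN : 6 ≤ N) :
    Chebyshev.theta N - Chebyshev.theta (N / 2 : ℕ) ≤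
      2 * (#(primesTwoModThree N) * Real.log N + 2 * √N * Real.log N) + Real.log N := by
  set b : ℕ → ℝ := fun n => if (N / n) % 3 = 1 then 1 else 0 with hb
  have hb0 : ∀ n, 0 ≤ b n := fun n => by simp only [hb]; split_ifs <;> norm_num
  have hb1 : ∀ n, b n ≤ 1 := fun n => by simp only [hb]; split_ifs <;> norm_num
  have h1 : ∑ n ∈ Ioc 0 N, chiThree n * vonMangoldt n * b n ≤ Real.log N := by
    rw [sum_Ioc_chiThree_mul_vonMangoldt]; exact sum_Ioc_chiThree_mul_log_le N
  have h2 : Chebyshev.theta N - Chebyshev.theta (N / 2 : ℕ) ≤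
      ∑ n ∈ Ioc 0 N, (chiThree n)^2 * vonMangoldt n * b n := by
    rw [Chebyshev.theta, Chebyshev.theta, Nat.floor_natCast, Nat.floor_natCast,
      ← Finset.Ioc_union_Ioc_eq_Ioc (Nat.zero_le (N / 2)) (Nat.div_le_self N 2),
      Finset.filter_union, Finset.sum_union (Finset.disjoint_filter_filter
        (Finset.Ioc_disjoint_Ioc_of_le le_rfl)), add_sub_cancel_left,
      Finset.Ioc_union_Ioc_eq_Ioc (Nat.zero_le (N / 2)) (Nat.div_le_self N 2)]
    refine (Finset.sum_le_sum_of_subset_of_nonneg (s := {p ∈ Ioc (N / 2) N | p.Prime})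
      (t := Ioc 0 N) (f := fun n => (chiThree n)^2 * vonMangoldt n * b n) ?_ ?_).trans' ?_
    · intro p hp
      simp only [Finset.mem_filter, Finset.mem_Ioc] at hp ⊢
      omega
    · intro n _ _
      have := vonMangoldt_nonneg (n := n)
      have := hb0 n
      positivity
    · refine Finset.sum_le_sum fun p hp => ?_
      simp only [Finset.mem_filter, Finset.mem_Ioc] at hp
      obtain ⟨⟨hp1, hp2⟩, hp⟩ := hp
      have hdiv : N / p = 1 := by
        rw [Nat.div_eq_iff (by omega)]; omega
      have h3 : p % 3 ≠ 0 := fun h => by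
        have := (Nat.prime_dvd_prime_iff_eq Nat.prime_three hp).1 (Nat.dvd_of_mod_eq_zero h)
        omega
      have h4 : (chiThree p)^2 = 1 := by
        rw [chiThree_apply]
        have : p % 3 = 1 ∨ p % 3 = 2 := by omega
        rcases this with h | h <;> simp [h]
      simp [h4, hb, hdiv, vonMangoldt_apply_prime hp]
  have h3 : ∑ n ∈ Ioc 0 N, (chiThree n)^2 * vonMangoldt n * b n -
      ∑ n ∈ Ioc 0 N, chiThree n * vonMangoldt n * b n ≤
      2 * ∑ n ∈ Ioc 0 N with n % 3 = 2, vonMangoldt n := by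
    rw [← Finset.sum_sub_distrib, Finset.sum_filter, Finset.mul_sum]
    refine Finset.sum_le_sum fun n _ => ?_
    rw [chiThree_apply]
    have := vonMangoldt_nonneg (n := n)
    have := hb0 n
    have := hb1 n
    split_ifs with h1 h2 h2 <;> first | omega | nlinarith
  have h4 : ∑ n ∈ Ioc 0 N with n % 3 = 2, vonMangoldt n ≤
      #(primesTwoModThree N) * Real.log N + 2 * √N * Real.log N := by
    rw [← Finset.sum_filter_add_sum_filter_not _ (fun n => n.Prime)]
    refine add_le_add ?_ ?_
    · rw [Finset.filter_filter, ← nsmul_eq_mul, primesTwoModThree]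
      simp only [and_comm]
      refine Finset.sum_le_card_nsmul _ _ _ fun p hp => ?_
      simp only [Finset.mem_filter, Finset.mem_Ioc] at hp
      rw [vonMangoldt_apply_prime hp.2.1]
      exact Real.log_le_log (by exact_mod_cast hp.1.1) (by exact_mod_cast hp.1.2)
    · refine le_trans ?_ (Chebyshev.psi_sub_theta_le (x := N) (by norm_cast; omega))
      rw [Chebyshev.psi_sub_theta_eq_sum_not_prime, Nat.floor_natCast]
      refine Finset.sum_le_sum_of_subset_of_nonneg ?_ fun _ _ _ => vonMangoldt_nonneg
      intro n hn
      simp only [Finset.mem_filter] at hn ⊢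
      exact ⟨hn.1.1, hn.2⟩
  linarith

theorem primesTwoModThree_mono {M N : ℕ} (h : M ≤ N) :
    primesTwoModThree M ⊆ primesTwoModThree N :=
  Finset.filter_subset_filter _ (Finset.Ioc_subset_Ioc_right h)

theorem mul_le_card_primesTwoModThree_mul_log {N : ℕ} (hN : 12 ≤ N) :
    N * (Real.log 2 / 2) ≤ 4 * #(primesTwoModThree N) * Real.log N +
      13 * (√N * Real.log N) := by
  have h1 := theta_sub_theta_half_le (show 6 ≤ N by omega)
  have h2 := theta_sub_theta_half_le (show 6 ≤ N / 2 by omega)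
  have h3 := Chebyshev.theta_ge N
  have h4 := Chebyshev.theta_le_log4_mul_x (x := (N / 2 / 2 : ℕ)) (by positivity)
  have hN1 : (12 : ℝ) ≤ N := by exact_mod_cast hN
  have hle : ((N / 2 : ℕ) : ℝ) ≤ N := by exact_mod_cast Nat.div_le_self N 2
  have hpos : (0 : ℝ) < (N / 2 : ℕ) := by
    have : 0 < N / 2 := by omega
    exact_mod_cast this
  have hlog : Real.log (N / 2 : ℕ) ≤ Real.log N := Real.log_le_log hpos hle
  have hsqrt : √((N / 2 : ℕ) : ℝ) ≤ √(N : ℝ) := Real.sqrt_le_sqrt hle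
  have hcard : (#(primesTwoModThree (N / 2)) : ℝ) ≤ #(primesTwoModThree N) := by
    exact_mod_cast Finset.card_le_card (primesTwoModThree_mono (Nat.div_le_self N 2))
  have hl0 : 0 ≤ Real.log (N / 2 : ℕ) := Real.log_natCast_nonneg _
  have hA : #(primesTwoModThree (N / 2)) * Real.log (N / 2 : ℕ) ≤
      #(primesTwoModThree N) * Real.log N := by gcongr
  have hB : √((N / 2 : ℕ) : ℝ) * Real.log (N / 2 : ℕ) ≤ √(N : ℝ) * Real.log N := by gcongr
  have hquarter : ((N / 2 / 2 : ℕ) : ℝ) ≤ N / 4 := by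
    have : 4 * (N / 2 / 2) ≤ N := by omega
    have : (4 : ℝ) * ((N / 2 / 2 : ℕ) : ℝ) ≤ N := by exact_mod_cast this
    linarith
  have hlog4 : Real.log 4 = 2 * Real.log 2 := by
    rw [show (4 : ℝ) = 2 ^ 2 by norm_num, Real.log_pow]; norm_num
  have hl2 : 0 < Real.log 2 := Real.log_pos (by norm_num)
  have h5 : Real.log 4 * ((N / 2 / 2 : ℕ) : ℝ) ≤ N * (Real.log 2 / 2) := by
    rw [hlog4]; nlinarith
  have h6 : Real.log (N + 1) ≤ 2 * Real.log N := by
    rw [show 2 * Real.log N = Real.log (N ^ 2 : ℝ) by rw [Real.log_pow]; norm_num]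
    exact Real.log_le_log (by positivity) (by nlinarith)
  have h7 : (3 : ℝ) ≤ √N := Real.le_sqrt_of_sq_le (by linarith)
  have h8 : 3 * Real.log N ≤ √N * Real.log N :=
    mul_le_mul_of_nonneg_right h7 (hl0.trans hlog)
  linarith

open Filter Asymptotics in
theorem exists_rpow_le_card_primesTwoModThree {δ : ℝ} (hδ : 0 < δ) :
    ∃ N₀ : ℕ, ∀ N : ℕ, N₀ ≤ N → 2 * (N : ℝ) ^ (1 - δ) ≤ #(primesTwoModThree N) := by
  have e1 : ∀ᶠ x : ℝ in atTop, ‖Real.log x‖ ≤ 1 / 1000 * ‖x ^ (min δ (1 / 2) / 2)‖ :=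
    (isLittleO_log_rpow_atTop (by positivity)).bound (by norm_num)
  have e2 : ∀ᶠ x : ℝ in atTop, 1000 ≤ x := eventually_ge_atTop _
  obtain ⟨N₀, hN₀⟩ := eventually_atTop.1
    (tendsto_natCast_atTop_atTop.eventually (e1.and e2))
  refine ⟨N₀, fun N hN => ?_⟩
  obtain ⟨h1, h2⟩ := hN₀ N hN
  have hN1 : 12 ≤ N := by
    have : (12 : ℝ) ≤ N := by linarith
    exact_mod_cast this
  have hx : (1 : ℝ) ≤ N := by linarith
  have h3 := mul_le_card_primesTwoModThree_mul_log hN1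
  rw [Real.norm_of_nonneg (Real.log_nonneg hx), Real.norm_of_nonneg (by positivity)] at h1
  have hl0 : 0 < Real.log N := Real.log_pos (by linarith)
  have hlδ : Real.log N ≤ 1 / 1000 * (N : ℝ) ^ δ := h1.trans (by
    gcongr
    linarith [min_le_left δ (1 / 2), min_le_right δ (1 / 2)])
  have hls : Real.log N ≤ 1 / 1000 * √N := h1.trans (by
    rw [Real.sqrt_eq_rpow]
    gcongr
    linarith [min_le_right δ (1 / 2)])
  have hl2 : 0.69 < Real.log 2 := by linarith [Real.log_two_gt_d9]
  have h4 : √N * Real.log N ≤ 1 / 1000 * N := by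
    calc √N * Real.log N ≤ √N * (1 / 1000 * √N) := by gcongr
      _ = 1 / 1000 * (√N * √N) := by ring
      _ = 1 / 1000 * N := by rw [Real.mul_self_sqrt (by linarith)]
  have h5 : (N : ℝ) * 0.3 ≤ 4 * #(primesTwoModThree N) * Real.log N := by nlinarith
  have h6 : (N : ℝ) * 0.3 ≤ 4 * #(primesTwoModThree N) * (1 / 1000 * (N : ℝ) ^ δ) :=
    h5.trans (by gcongr)
  rw [Real.rpow_sub (by linarith), Real.rpow_one, mul_div_assoc',
    div_le_iff₀ (by positivity)]
  have : (0 : ℝ) ≤ #(primesTwoModThree N) * (N : ℝ) ^ δ := by positivity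
  linarith

end PrimesTwoModThree

section IdealCount

open Ideal UniqueFactorizationMonoid

variable {K : Type*} [Field K] [NumberField K]

theorem ncard_primesOver_le_finrank (p : Ideal ℤ) [p.IsMaximal] :
    (p.primesOver (𝓞 K)).ncard ≤ Module.finrank ℚ K := by
  have : Finite (p.primesOver (𝓞 K)) := IsDedekindDomain.primesOver_finite p (𝓞 K)
  have := Fintype.ofFinite (p.primesOver (𝓞 K))
  rw [← Nat.card_coe_set_eq, Nat.card_eq_fintype_card, ← RingOfIntegers.rank,
    ← Ideal.sum_ramification_inertia_eq_finrank (p := p), Fintype.card_eq_sum_ones]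
  refine Finset.sum_le_sum fun q _ => ?_
  have hq : q.1.IsPrime := q.2.1
  exact Nat.mul_pos (ramificationIdx_pos ..) (inertiaDeg_pos ..)

theorem exists_label_primes :
    ∃ lab : Ideal (𝓞 K) → Fin (Module.finrank ℚ K), ∀ P Q : Ideal (𝓞 K), P.IsPrime → Q.IsPrime →
      P ≠ ⊥ → P.under ℤ = Q.under ℤ → lab P = lab Q → P = Q := by
  have hfin : 0 < Module.finrank ℚ K := Module.finrank_pos
  have key : ∀ p : Ideal ℤ, ∃ f : Ideal (𝓞 K) → Fin (Module.finrank ℚ K),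
      p.IsMaximal → p ≠ ⊥ → Set.InjOn f (p.primesOver (𝓞 K)) := by
    intro p
    by_cases hp : p.IsMaximal ∧ p ≠ ⊥
    · obtain ⟨hp1, hp2⟩ := hp
      have : Finite (p.primesOver (𝓞 K)) := IsDedekindDomain.primesOver_finite p (𝓞 K)
      have : Nonempty (Fin (Module.finrank ℚ K)) := ⟨⟨0, hfin⟩⟩
      obtain ⟨f, -, hf⟩ := (Set.toFinite (p.primesOver (𝓞 K))).exists_injOn_of_encard_le
        (t := (Set.univ : Set (Fin (Module.finrank ℚ K)))) (by
          rw [Set.encard_univ, ENat.card_eq_coe_fintype_card, Fintype.card_fin,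
            ← (Set.toFinite _).cast_ncard_eq]
          exact_mod_cast ncard_primesOver_le_finrank p)
      exact ⟨f, fun _ _ => hf⟩
    · exact ⟨fun _ => ⟨0, hfin⟩, fun h1 h2 => absurd ⟨h1, h2⟩ hp⟩
  choose f hf using key
  refine ⟨fun P => f (P.under ℤ) P, fun P Q hP hQ hP0 h hlab => ?_⟩
  have hmax : (P.under ℤ).IsMaximal := by
    have : P.IsMaximal := hP.isMaximal hP0
    infer_instance
  have hbot : P.under ℤ ≠ ⊥ := mt Ideal.eq_bot_of_comap_eq_bot hP0
  refine hf _ hmax hbot ⟨hP, ⟨rfl⟩⟩ ⟨hQ, ⟨h⟩⟩ ?_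
  simpa [← h] using hlab

theorem under_int_eq_of_prime_dvd_absNorm {P Q : Ideal (𝓞 K)} [P.IsPrime] [Q.IsPrime]
    (hP : P ≠ ⊥) (hQ : Q ≠ ⊥) (h : absNorm (P.under ℤ) ∣ absNorm Q) : P.under ℤ = Q.under ℤ := by
  have : NeZero P := ⟨hP⟩
  have : NeZero Q := ⟨hQ⟩
  have h1 := Nat.absNorm_under_prime P
  have h2 := Nat.absNorm_under_prime Q
  have hmem : ((absNorm (Q.under ℤ) : ℕ) : 𝓞 K) ∈ Q := by
    have := Int.absNorm_under_mem Q
    exact_mod_cast this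
  have h3 : absNorm Q ∣ absNorm (Q.under ℤ) ^ Module.finrank ℤ (𝓞 K) := by
    rw [← absNorm_span_natCast (S := 𝓞 K)]
    exact absNorm_dvd_absNorm_of_le ((span_singleton_le_iff_mem _).2 hmem)
  have h4 := (Nat.prime_dvd_prime_iff_eq h1 h2).1 (h1.dvd_of_dvd_pow (h.trans h3))
  rw [← Int.ideal_span_absNorm_eq_self (P.under ℤ), ← Int.ideal_span_absNorm_eq_self (Q.under ℤ),
    h4]

theorem factorization_prod_absNorm {lab : Ideal (𝓞 K) → Fin (Module.finrank ℚ K)}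
    (hlab : ∀ P Q : Ideal (𝓞 K), P.IsPrime → Q.IsPrime →
      P ≠ ⊥ → P.under ℤ = Q.under ℤ → lab P = lab Q → P = Q)
    {P : Ideal (𝓞 K)} [P.IsPrime] (hP : P ≠ ⊥) (s : Multiset (Ideal (𝓞 K)))
    (hs : ∀ Q ∈ s, Q.IsPrime ∧ Q ≠ ⊥ ∧ lab Q = lab P) :
    (s.map absNorm).prod.factorization (absNorm (P.under ℤ)) =
      s.count P * (absNorm P).factorization (absNorm (P.under ℤ)) := by
  classical
  induction s using Multiset.induction_on with
  | empty => simp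
  | cons Q s ih =>
    have hs' : ∀ R ∈ s, R.IsPrime ∧ R ≠ ⊥ ∧ lab R = lab P :=
      fun R hR => hs R (Multiset.mem_cons_of_mem hR)
    obtain ⟨hQ1, hQ2, hQ3⟩ := hs Q (Multiset.mem_cons_self Q s)
    have hprod : (s.map absNorm).prod ≠ 0 := by
      rw [Ne, Multiset.prod_eq_zero_iff, Multiset.mem_map]
      rintro ⟨R, hR, hR0⟩
      exact (hs' R hR).2.1 (absNorm_eq_zero_iff.1 hR0)
    rw [Multiset.map_cons, Multiset.prod_cons,
      Nat.factorization_mul (mt absNorm_eq_zero_iff.1 hQ2) hprod, Finsupp.add_apply, ih hs']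
    by_cases hPQ : P = Q
    · subst hPQ
      rw [Multiset.count_cons_self]
      ring
    · rw [Multiset.count_cons_of_ne hPQ, Nat.factorization_eq_zero_of_not_dvd, zero_add]
      exact fun h => hPQ (hlab P Q ‹_› hQ1 hP (under_int_eq_of_prime_dvd_absNorm hP hQ2 h) hQ3.symm)

theorem exists_injOn_prod_eq_absNorm :
    ∃ F : Ideal (𝓞 K) → Fin (Module.finrank ℚ K) → ℕ,
      (∀ I, I ≠ ⊥ → ∏ j, F I j = absNorm I) ∧ Set.InjOn F {I | I ≠ ⊥} := by
  classical
  obtain ⟨lab, hlab⟩ := exists_label_primes (K := K)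
  have hfac : ∀ {I Q : Ideal (𝓞 K)}, I ≠ ⊥ → Q ∈ normalizedFactors I → Q.IsPrime ∧ Q ≠ ⊥ := by
    intro I Q _ hQ
    have := prime_of_normalized_factor Q hQ
    exact ⟨isPrime_of_prime this, this.ne_zero⟩
  refine ⟨fun I j => (((normalizedFactors I).filter (lab · = j)).map absNorm).prod, ?_, ?_⟩
  · intro I hI
    have h : absNorm I = ((normalizedFactors I).map absNorm).prod := by
      conv_lhs => rw [← Ideal.prod_normalizedFactors_eq_self hI]
      exact map_multiset_prod absNorm _
    rw [h]
    beta_reduce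
    generalize normalizedFactors I = s
    induction s using Multiset.induction_on with
    | empty => simp
    | cons Q s ih =>
      rw [Multiset.map_cons, Multiset.prod_cons, ← ih,
        ← Finset.mul_prod_erase _ _ (Finset.mem_univ (lab Q)),
        ← Finset.mul_prod_erase Finset.univ
          (fun j => ((s.filter (lab · = j)).map absNorm).prod) (Finset.mem_univ (lab Q)),
        Multiset.filter_cons_of_pos (p := (lab · = lab Q)) _ rfl, Multiset.map_cons, Multiset.prod_cons,
        mul_assoc]
      congr 2
      refine Finset.prod_congr rfl fun j hj => ?_
      rw [Multiset.filter_cons_of_neg (p := (lab · = j)) _ (Finset.ne_of_mem_erase hj).symm]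
  · intro I hI J hJ hIJ
    rw [← Ideal.prod_normalizedFactors_eq_self hI, ← Ideal.prod_normalizedFactors_eq_self hJ]
    congr 1
    ext P
    by_cases hP : P.IsPrime ∧ P ≠ ⊥
    · obtain ⟨hP1, hP2⟩ := hP
      have hne : NeZero P := ⟨hP2⟩
      have hcount : ∀ I : Ideal (𝓞 K), I ≠ ⊥ →
          (((normalizedFactors I).filter (lab · = lab P)).map absNorm).prod.factorization
            (absNorm (P.under ℤ)) = (normalizedFactors I).count P *
              (absNorm P).factorization (absNorm (P.under ℤ)) := by
        intro I hI
        rw [factorization_prod_absNorm hlab hP2,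
          Multiset.count_filter_of_pos (p := (lab · = lab P)) rfl]
        intro Q hQ
        obtain ⟨hQ1, hQ2⟩ := Multiset.mem_filter.1 hQ
        exact ⟨(hfac hI hQ1).1, (hfac hI hQ1).2, hQ2⟩
      have h1 := hcount I hI
      have h2 := hcount J hJ
      have h3 := congrFun hIJ (lab P)
      simp only at h3
      rw [h3, h2] at h1
      refine (Nat.eq_of_mul_eq_mul_right ?_ h1).symm
      exact (Nat.absNorm_under_prime P).factorization_pos_of_dvd
        (mt absNorm_eq_zero_iff.1 hP2) (Int.absNorm_under_dvd_absNorm P)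
    · rw [Multiset.count_eq_zero_of_notMem (fun h => hP (hfac hI h)),
        Multiset.count_eq_zero_of_notMem (fun h => hP (hfac hJ h))]

theorem finite_setOf_absNorm_le_nat (Y : ℕ) :
    {I : Ideal (𝓞 K) | I ≠ ⊥ ∧ absNorm I ≤ Y}.Finite :=
  (finite_setOfPred_absNorm_le Y).subset fun _ h => h.2

theorem ncard_absNorm_le (hK : Module.finrank ℚ K = 3) (Y : ℕ) :
    ({I : Ideal (𝓞 K) | I ≠ ⊥ ∧ absNorm I ≤ Y}.ncard : ℝ) ≤ Y * (1 + Real.log Y) ^ 2 := by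
  obtain ⟨F, hF1, hF2⟩ := exists_injOn_prod_eq_absNorm (K := K)
  set G : Ideal (𝓞 K) → (_ : ℕ × ℕ) × ℕ := fun I =>
    ⟨(F I (finCongr hK.symm 0), F I (finCongr hK.symm 1)), F I (finCongr hK.symm 2)⟩ with hG
  set T : Finset ((_ : ℕ × ℕ) × ℕ) :=
    (Finset.Icc 1 Y ×ˢ Finset.Icc 1 Y).sigma fun x => Finset.Icc 1 (Y / (x.1 * x.2)) with hT
  have hprod : ∀ I : Ideal (𝓞 K), I ≠ ⊥ →
      F I (finCongr hK.symm 0) * F I (finCongr hK.symm 1) * F I (finCongr hK.symm 2) =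
        absNorm I := by
    intro I hI
    rw [← hF1 I hI, ← (finCongr hK.symm).prod_comp, Fin.prod_univ_three]
  have hmaps : ∀ I ∈ {I : Ideal (𝓞 K) | I ≠ ⊥ ∧ absNorm I ≤ Y}, G I ∈ (T : Set _) := by
    rintro I ⟨hI, hIY⟩
    rw [← hprod I hI] at hIY
    have hpos : 0 < F I (finCongr hK.symm 0) * F I (finCongr hK.symm 1) *
        F I (finCongr hK.symm 2) := by
      rw [hprod I hI]
      exact Nat.pos_of_ne_zero (mt absNorm_eq_zero_iff.1 hI)
    simp only [hG, hT, Finset.coe_sigma, Set.mem_sigma_iff, Finset.mem_coe, Finset.mem_product,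
      Finset.mem_Icc]
    generalize F I (finCongr hK.symm 0) = x at *
    generalize F I (finCongr hK.symm 1) = y at *
    generalize F I (finCongr hK.symm 2) = z at *
    have hxy : 0 < x * y := Nat.pos_of_mul_pos_right hpos
    have hz : 0 < z := Nat.pos_of_mul_pos_left hpos
    have hx : 0 < x := Nat.pos_of_mul_pos_right hxy
    have hy : 0 < y := Nat.pos_of_mul_pos_left hxy
    have hxyY : x * y ≤ Y := (Nat.le_mul_of_pos_right _ hz).trans hIY
    refine ⟨⟨⟨hx, (Nat.le_mul_of_pos_right _ hy).trans hxyY⟩, hy,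
      (Nat.le_mul_of_pos_left _ hx).trans hxyY⟩, hz, ?_⟩
    rw [Nat.le_div_iff_mul_le hxy]
    linarith
  have hinj : Set.InjOn G {I : Ideal (𝓞 K) | I ≠ ⊥ ∧ absNorm I ≤ Y} := by
    rintro I ⟨hI, -⟩ J ⟨hJ, -⟩ h
    refine hF2 hI hJ (funext fun j => ?_)
    obtain ⟨i, rfl⟩ := (finCongr hK.symm).surjective j
    simp only [hG, Sigma.mk.injEq, Prod.mk.injEq, heq_eq_eq] at h
    fin_cases i
    exacts [h.1.1, h.1.2, h.2]
  have h1 := Set.ncard_le_ncard_of_injOn G hmaps hinj T.finite_toSet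
  rw [Set.ncard_coe_finset] at h1
  have hH : ∑ i ∈ Finset.Icc 1 Y, (i : ℝ)⁻¹ ≤ 1 + Real.log Y := by
    have := harmonic_le_one_add_log Y
    rwa [harmonic_eq_sum_Icc, Rat.cast_sum, Finset.sum_congr rfl
      (fun i _ => by rw [Rat.cast_inv, Rat.cast_natCast])] at this
  calc ({I : Ideal (𝓞 K) | I ≠ ⊥ ∧ absNorm I ≤ Y}.ncard : ℝ) ≤ (T.card : ℝ) := by exact_mod_cast h1
    _ ≤ ∑ x ∈ Finset.Icc 1 Y ×ˢ Finset.Icc 1 Y, (Y : ℝ) * ((x.1 : ℝ)⁻¹ * (x.2 : ℝ)⁻¹) := by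
      rw [hT, Finset.card_sigma]
      push_cast
      refine Finset.sum_le_sum fun x _ => ?_
      rw [Nat.card_Icc, Nat.add_sub_cancel]
      refine Nat.cast_div_le.trans (le_of_eq ?_)
      rw [Nat.cast_mul, div_eq_mul_inv, mul_inv]
    _ = Y * (∑ i ∈ Finset.Icc 1 Y, (i : ℝ)⁻¹) ^ 2 := by
      rw [← Finset.mul_sum, Finset.sum_product, sq, Finset.sum_mul_sum]
    _ ≤ Y * (1 + Real.log Y) ^ 2 := by gcongr

end IdealCount

section Minkowski

open NumberField.mixedEmbedding NumberField.InfinitePlace nonZeroDivisors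

variable {K : Type*} [Field K] [NumberField K]

theorem exists_ne_zero_mem_ideal_forall_lt {J : Ideal (𝓞 K)} (hJ : J ≠ ⊥)
    {g : InfinitePlace K → ℝ} (hg : ∀ w, 0 ≤ g w)
    (h : 2 ^ Module.finrank ℚ K * √|(discr K : ℝ)| * Ideal.absNorm J < ∏ w, g w ^ w.mult) :
    ∃ x : 𝓞 K, x ∈ J ∧ x ≠ 0 ∧ ∀ w : InfinitePlace K, w (x : K) < g w := by
  classical
  let I : (FractionalIdeal (𝓞 K)⁰ K)ˣ :=
    Units.mk0 (J : FractionalIdeal (𝓞 K)⁰ K) (by simpa using hJ)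
  have hI : FractionalIdeal.absNorm I.1 = Ideal.absNorm J :=
    FractionalIdeal.coeIdeal_absNorm J
  let f : InfinitePlace K → NNReal := fun w => ⟨g w, hg w⟩
  have hvol : minkowskiBound K I < MeasureTheory.volume (convexBodyLT K f) := by
    rw [convexBodyLT_volume, ← ENNReal.toReal_lt_toReal (minkowskiBound_lt_top K I).ne
      (ENNReal.mul_ne_top ENNReal.coe_ne_top ENNReal.coe_ne_top)]
    rw [minkowskiBound, volume_fundamentalDomain_fractionalIdealLatticeBasis,
        volume_fundamentalDomain_latticeBasis, hI, mixedEmbedding.finrank]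
    simp only [ENNReal.toReal_mul, ENNReal.toReal_pow, ENNReal.toReal_inv, ENNReal.coe_toReal,
      ENNReal.toReal_ofNat, NNReal.coe_prod, NNReal.coe_pow]
    rw [ENNReal.toReal_ofReal (by positivity)]
    have h1 : (1 : ℝ) ≤ convexBodyLTFactor K := one_le_convexBodyLTFactor K
    have h2 : (2 : ℝ)⁻¹ ^ nrComplexPlaces K ≤ 1 := pow_le_one₀ (by norm_num) (by norm_num)
    have h3 : (0 : ℝ) ≤ ∏ w, g w ^ w.mult :=
      Finset.prod_nonneg fun w _ => pow_nonneg (hg w) _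
    have h4 : ((NNReal.sqrt ‖discr K‖₊ : NNReal) : ℝ) = √|(discr K : ℝ)| := by
      rw [Real.coe_sqrt, coe_nnnorm, Int.norm_eq_abs]
    rw [h4]
    have h5 : (0 : ℝ) ≤ 2 ^ Module.finrank ℚ K * √|(discr K : ℝ)| * Ideal.absNorm J := by
      positivity
    calc _ = (2 : ℝ)⁻¹ ^ nrComplexPlaces K *
          (2 ^ Module.finrank ℚ K * √|(discr K : ℝ)| * Ideal.absNorm J) := by push_cast; ring
      _ ≤ 1 * (2 ^ Module.finrank ℚ K * √|(discr K : ℝ)| * Ideal.absNorm J) := by gcongr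
      _ < 1 * ∏ w, g w ^ w.mult := by simpa using h
      _ ≤ convexBodyLTFactor K * ∏ w, g w ^ w.mult := by gcongr
  obtain ⟨x, hx, hx0, hxw⟩ := exists_ne_zero_mem_ideal_lt K I hvol
  obtain ⟨y, hy, rfl⟩ := (FractionalIdeal.mem_coeIdeal _).1 hx
  exact ⟨y, hy, by simpa using hx0, hxw⟩

theorem exists_balanced_generator (hK : Module.finrank ℚ K = 3) {ℓ : ℕ} (hℓ : 0 < ℓ)
    {c : ClassGroup (𝓞 K)} (hc : c ^ ℓ = 1) (A : (Ideal (𝓞 K))⁰) :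
    ∃ (I J : (Ideal (𝓞 K))⁰) (x γ : 𝓞 K) (f : InfinitePlace K → ℝ),
      ClassGroup.mk0 J = c ∧ Ideal.span {γ} = (J : Ideal (𝓞 K)) ^ ℓ ∧
      Ideal.span {x} = (I : Ideal (𝓞 K)) * A * J ∧ x ≠ 0 ∧ γ ≠ 0 ∧
      (Ideal.absNorm (I : Ideal (𝓞 K)) : ℝ) ≤ 16 * √|(discr K : ℝ)| ∧
      (∀ w, (16 * √|(discr K : ℝ)|)⁻¹ ≤ f w ∧ f w ≤ 1) ∧
      ∀ w : InfinitePlace K, w x ^ (3 * ℓ) =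
        f w ^ (3 * ℓ) * (16 * √|(discr K : ℝ)| * Ideal.absNorm (A : Ideal (𝓞 K))) ^ ℓ *
          w γ ^ 3 := by
  obtain ⟨J, rfl⟩ := ClassGroup.mk0_surjective c
  set Y : ℝ := 16 * √|(discr K : ℝ)| with hY
  have hD : 0 < √|(discr K : ℝ)| :=
    Real.sqrt_pos.2 (abs_pos.2 (by exact_mod_cast discr_ne_zero K))
  have hY0 : 0 < Y := by positivity
  have hJ0 : (J : Ideal (𝓞 K)) ≠ ⊥ := nonZeroDivisors.coe_ne_zero J
  have hA0 : (A : Ideal (𝓞 K)) ≠ ⊥ := nonZeroDivisors.coe_ne_zero A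
  have hNJ : (0 : ℝ) < Ideal.absNorm (J : Ideal (𝓞 K)) := by
    exact_mod_cast Nat.pos_of_ne_zero (mt Ideal.absNorm_eq_zero_iff.1 hJ0)
  have hNA : (0 : ℝ) < Ideal.absNorm (A : Ideal (𝓞 K)) := by
    exact_mod_cast Nat.pos_of_ne_zero (mt Ideal.absNorm_eq_zero_iff.1 hA0)
  rw [← map_pow, ClassGroup.mk0_eq_one_iff] at hc
  obtain ⟨γ, hγ⟩ := hc
  have hγ' : (J : Ideal (𝓞 K)) ^ ℓ = Ideal.span {γ} := by simpa using hγ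
  have hγ0 : γ ≠ 0 := by
    rintro rfl
    exact pow_ne_zero ℓ hJ0 (by simpa using hγ')
  have hwγ : ∀ w : InfinitePlace K, 0 < w (γ : K) := fun w =>
    InfinitePlace.pos_iff.2 (by simpa using hγ0)
  have hnorm : ∀ z : 𝓞 K, ∏ w : InfinitePlace K, w (z : K) ^ w.mult =
      Ideal.absNorm (Ideal.span {z}) := by
    intro z
    rw [InfinitePlace.prod_eq_abs_norm, Ideal.absNorm_span_singleton, ← Algebra.coe_norm_int,
      Nat.cast_natAbs]
    push_cast
    rfl
  set g : InfinitePlace K → ℝ := fun w =>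
    (Y * Ideal.absNorm (A : Ideal (𝓞 K))) ^ (1 / 3 : ℝ) * w (γ : K) ^ (1 / ℓ : ℝ) with hg
  have hg0 : ∀ w, 0 < g w := fun w => by
    have := hwγ w
    positivity
  have hℓ' : (ℓ : ℝ) ≠ 0 := by exact_mod_cast hℓ.ne'
  have hgprod : ∏ w, g w ^ w.mult =
      Y * Ideal.absNorm (A : Ideal (𝓞 K)) * Ideal.absNorm (J : Ideal (𝓞 K)) := by
    simp only [hg, mul_pow, Finset.prod_mul_distrib]
    rw [Finset.prod_pow_eq_pow_sum, InfinitePlace.sum_mult_eq, hK, ← Real.rpow_natCast,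
      ← Real.rpow_mul (by positivity)]
    have h1 : ∀ w : InfinitePlace K, (w (γ : K) ^ (1 / ℓ : ℝ)) ^ w.mult =
        (w (γ : K) ^ w.mult) ^ (1 / ℓ : ℝ) := fun w => by
      rw [← Real.rpow_natCast, ← Real.rpow_mul (hwγ w).le, mul_comm,
        Real.rpow_mul (hwγ w).le, Real.rpow_natCast]
    rw [Finset.prod_congr rfl fun w _ => h1 w,
      Real.finsetProd_rpow _ _ fun w _ => pow_nonneg (hwγ w).le _, hnorm, ← hγ', map_pow,
      Nat.cast_pow, ← Real.rpow_natCast (_ : ℝ) ℓ, ← Real.rpow_mul hNJ.le,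
      mul_one_div_cancel hℓ']
    norm_num
  obtain ⟨x, hxmem, hx0, hxw⟩ := exists_ne_zero_mem_ideal_forall_lt
    (J := (A : Ideal (𝓞 K)) * (J : Ideal (𝓞 K))) (mul_ne_zero hA0 hJ0) (g := g) (fun w => (hg0 w).le)
    (by
      rw [hgprod, hK, map_mul, hY]
      push_cast
      have : 0 < √|(discr K : ℝ)| * (Ideal.absNorm (A : Ideal (𝓞 K)) *
        Ideal.absNorm (J : Ideal (𝓞 K))) := by positivity
      linarith)
  obtain ⟨I, hI⟩ := Ideal.dvd_span_singleton.2 hxmem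
  have hI0 : I ≠ ⊥ := by
    rintro rfl
    exact hx0 (by simpa using hI)
  have hNI : (1 : ℝ) ≤ Ideal.absNorm I := by
    exact_mod_cast Nat.pos_of_ne_zero (mt Ideal.absNorm_eq_zero_iff.1 hI0)
  have hfle : ∀ w, w (x : K) / g w ≤ 1 := fun w => (div_le_one (hg0 w)).2 (hxw w).le
  have hf0 : ∀ w, 0 ≤ w (x : K) / g w := fun w => div_nonneg (apply_nonneg _ _) (hg0 w).le
  have hfprod : ∏ w, (w (x : K) / g w) ^ w.mult = Ideal.absNorm I / Y := by
    simp only [div_pow]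
    rw [Finset.prod_div_distrib, hgprod, hnorm, hI, map_mul, map_mul]
    push_cast
    field_simp
  refine ⟨⟨I, mem_nonZeroDivisors_of_ne_zero hI0⟩, J, x, γ, fun w => w (x : K) / g w, rfl,
    hγ'.symm, by rw [hI]; ring, hx0, hγ0, ?_, fun w => ⟨?_, hfle w⟩, fun w => ?_⟩
  · rw [← div_le_one hY0, ← hfprod]
    exact Finset.prod_le_one (fun w _ => pow_nonneg (hf0 w) _)
      fun w _ => pow_le_one₀ (hf0 w) (hfle w)
  · calc Y⁻¹ ≤ Ideal.absNorm I / Y := by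
          rw [inv_eq_one_div]
          gcongr
      _ = ∏ w, (w (x : K) / g w) ^ w.mult := hfprod.symm
      _ ≤ (w (x : K) / g w) ^ w.mult := by
          classical
          rw [← Finset.mul_prod_erase _ _ (Finset.mem_univ w)]
          exact mul_le_of_le_one_right (pow_nonneg (hf0 w) _)
            (Finset.prod_le_one (fun w _ => pow_nonneg (hf0 w) _)
              fun w _ => pow_le_one₀ (hf0 w) (hfle w))
      _ ≤ w (x : K) / g w := pow_le_of_le_one (hf0 w) (hfle w) InfinitePlace.mult_ne_zero
  · have h1 : ((Y * Ideal.absNorm (A : Ideal (𝓞 K))) ^ (1 / 3 : ℝ)) ^ 3 =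
        Y * Ideal.absNorm (A : Ideal (𝓞 K)) := by
      rw [← Real.rpow_natCast, ← Real.rpow_mul (by positivity)]
      norm_num
    have h2 : (w (γ : K) ^ (1 / ℓ : ℝ)) ^ ℓ = w (γ : K) := by
      rw [← Real.rpow_natCast, ← Real.rpow_mul (hwγ w).le, one_div_mul_cancel hℓ', Real.rpow_one]
    have h3 : g w ^ (3 * ℓ) = (Y * Ideal.absNorm (A : Ideal (𝓞 K))) ^ ℓ * w (γ : K) ^ 3 := by
      rw [hg, mul_pow, pow_mul, h1, mul_comm 3 ℓ, pow_mul, h2]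
    rw [mul_assoc, ← h3, ← mul_pow, div_mul_cancel₀ _ (hg0 w).ne']

theorem card_infinitePlace_le_finrank : Fintype.card (InfinitePlace K) ≤ Module.finrank ℚ K := by
  rw [← InfinitePlace.sum_mult_eq, ← Finset.card_univ, Finset.card_eq_sum_ones]
  exact Finset.sum_le_sum fun w _ => InfinitePlace.mult_pos

theorem le_three_mul_of_floor_log_eq {n : ℕ} {s t : ℝ} (hs : 0 < s) (ht : 0 < t) (ht1 : t ≤ 1)
    (h : ⌊-(n * Real.log s)⌋₊ = ⌊-(n * Real.log t)⌋₊) : t ^ n ≤ 3 * s ^ n := by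
  have h0 : (n : ℝ) * Real.log t ≤ 0 :=
    mul_nonpos_of_nonneg_of_nonpos n.cast_nonneg (Real.log_nonpos ht.le ht1)
  have h1 := Nat.floor_le (neg_nonneg.2 h0)
  have h2 := Nat.lt_floor_add_one (-(n * Real.log s))
  rw [h] at h2
  have h3 : n * Real.log t ≤ 1 + n * Real.log s := by linarith
  calc t ^ n = Real.exp (n * Real.log t) := by
        rw [Real.exp_nat_mul, Real.exp_log ht]
    _ ≤ Real.exp (1 + n * Real.log s) := Real.exp_le_exp.2 h3
    _ = Real.exp 1 * s ^ n := by rw [Real.exp_add, Real.exp_nat_mul, Real.exp_log hs]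
    _ ≤ 3 * s ^ n := by
        gcongr
        exact Real.exp_one_lt_three.le

theorem card_torsion_mul_card_le (hK : Module.finrank ℚ K = 3) {ℓ : ℕ} (hℓ : 0 < ℓ)
    (T : Finset (Ideal (𝓞 K))⁰)
    (hT : ∀ A ∈ T, ∀ B ∈ T, ∀ x y : 𝓞 K, x ≠ 0 → y ≠ 0 →
      Ideal.span {x} * (A : Ideal (𝓞 K)) ^ ℓ = Ideal.span {y} * (B : Ideal (𝓞 K)) ^ ℓ →
      (∀ w : InfinitePlace K, w x ^ 3 * (Ideal.absNorm (A : Ideal (𝓞 K)) : ℝ) ^ ℓ ≤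
        3 * (w y ^ 3 * (Ideal.absNorm (B : Ideal (𝓞 K)) : ℝ) ^ ℓ)) → A = B)
    (hfin : {I : Ideal (𝓞 K) | I ≠ ⊥ ∧ Ideal.absNorm I ≤ ⌊16 * √|(discr K : ℝ)|⌋₊}.Finite) :
    Nat.card {c : ClassGroup (𝓞 K) // c ^ ℓ = 1} * T.card ≤
      {I : Ideal (𝓞 K) | I ≠ ⊥ ∧ Ideal.absNorm I ≤ ⌊16 * √|(discr K : ℝ)|⌋₊}.ncard *
        (⌊3 * ℓ * Real.log (16 * √|(discr K : ℝ)|)⌋₊ + 1) ^ 3 := by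
  classical
  have hD : 0 < √|(discr K : ℝ)| :=
    Real.sqrt_pos.2 (abs_pos.2 (by exact_mod_cast discr_ne_zero K))
  have hY0 : 0 < 16 * √|(discr K : ℝ)| := by positivity
  choose I J x γ f hJ hγ hx hx0 hγ0 hIle hf hw using
    fun p : {c : ClassGroup (𝓞 K) // c ^ ℓ = 1} × T =>
      exists_balanced_generator hK hℓ p.1.2 p.2.1
  have hfpos : ∀ p w, 0 < f p w := fun p w => (inv_pos.2 hY0).trans_le (hf p w).1
  set n : ℕ := ⌊3 * ℓ * Real.log (16 * √|(discr K : ℝ)|)⌋₊ with hn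
  have hbin : ∀ p w, ⌊-((3 * ℓ : ℕ) * Real.log (f p w))⌋₊ < n + 1 := fun p w => by
    rw [Nat.lt_succ_iff, hn]
    refine Nat.floor_le_floor ?_
    have := Real.log_le_log (inv_pos.2 hY0) (hf p w).1
    rw [Real.log_inv] at this
    push_cast
    have h3 : (0 : ℝ) ≤ 3 * ℓ := by positivity
    nlinarith
  have := hfin.to_subtype
  let F : {c : ClassGroup (𝓞 K) // c ^ ℓ = 1} × T →
      {I : Ideal (𝓞 K) | I ≠ ⊥ ∧ Ideal.absNorm I ≤ ⌊16 * √|(discr K : ℝ)|⌋₊} ×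
        (InfinitePlace K → Fin (n + 1)) := fun p =>
    (⟨I p, nonZeroDivisors.coe_ne_zero (I p), Nat.le_floor (hIle p)⟩,
      fun w => ⟨⌊-((3 * ℓ : ℕ) * Real.log (f p w))⌋₊, hbin p w⟩)
  have hF : Function.Injective F := by
    intro p q hpq
    simp only [F, Prod.mk.injEq, Subtype.mk.injEq, funext_iff, Fin.mk.injEq] at hpq
    obtain ⟨hI, hb⟩ := hpq
    have hAB : (p.2 : (Ideal (𝓞 K))⁰) = q.2 := by
      refine hT _ p.2.2 _ q.2.2 (x q ^ ℓ * γ p) (x p ^ ℓ * γ q)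
        (mul_ne_zero (pow_ne_zero _ (hx0 q)) (hγ0 p)) (mul_ne_zero (pow_ne_zero _ (hx0 p)) (hγ0 q))
        ?_ fun w => ?_
      · simp only [← Ideal.span_singleton_mul_span_singleton, ← Ideal.span_singleton_pow, hx, hγ,
          hI]
        ring
      · have h1 := le_three_mul_of_floor_log_eq (hfpos p w) (hfpos q w) (hf q w).2 (hb w)
        have h2 : ∀ p q, w ((x q ^ ℓ * γ p : 𝓞 K) : K) ^ 3 =
            w (x q : K) ^ (3 * ℓ) * w (γ p : K) ^ 3 :=
          fun p q => by
            push_cast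
            rw [map_mul, map_pow]
            ring
        rw [h2, h2, hw, hw]
        have h3 : 0 ≤ (16 * √|(discr K : ℝ)|) ^ ℓ * w (γ q : K) ^ 3 * w (γ p : K) ^ 3 *
          (Ideal.absNorm (p.2 : Ideal (𝓞 K)) : ℝ) ^ ℓ *
          (Ideal.absNorm (q.2 : Ideal (𝓞 K)) : ℝ) ^ ℓ := by positivity
        have h4 := mul_le_mul_of_nonneg_right h1 h3
        rw [mul_pow (16 * √|(discr K : ℝ)|), mul_pow (16 * √|(discr K : ℝ)|)]
        linarith
    have hcl : ∀ p, ClassGroup.mk0 (I p) * ClassGroup.mk0 (p.2 : (Ideal (𝓞 K))⁰) * p.1 = 1 :=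
      fun p => by
        rw [← hJ, ← map_mul, ← map_mul, ClassGroup.mk0_eq_one_iff]
        exact ⟨x p, by simpa using (hx p).symm⟩
    have h5 := (hcl p).trans (hcl q).symm
    rw [hAB, Subtype.ext hI, mul_right_inj] at h5
    exact Prod.ext (Subtype.ext h5) (Subtype.ext hAB)
  have hcard := Nat.card_le_card_of_injective F hF
  rw [Nat.card_prod, Nat.card_prod, Nat.card_eq_fintype_card (α := T), Fintype.card_coe,
    Nat.card_coe_set_eq, Nat.card_fun, Nat.card_fin,
    Nat.card_eq_fintype_card (α := InfinitePlace K)] at hcard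
  refine hcard.trans (Nat.mul_le_mul_left _ (Nat.pow_le_pow_right n.succ_pos ?_))
  exact hK ▸ card_infinitePlace_le_finrank

end Minkowski

section PureCubicField

variable {K : Type*} [Field K] [NumberField K] {a : ℕ} {θ : 𝓞 K}

theorem abs_discr_le_abs_discr_of_ne_zero {n : ℕ} (hK : Module.finrank ℚ K = n)
    {v : Fin n → 𝓞 K} (hv : Algebra.discr ℤ v ≠ 0) : |discr K| ≤ |Algebra.discr ℤ v| := by
  have hcard : Fintype.card (Module.Free.ChooseBasisIndex ℤ (𝓞 K)) = n := by
    rw [← Module.finrank_eq_card_chooseBasisIndex, RingOfIntegers.rank, hK]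
  let b := (RingOfIntegers.basis K).reindex (Fintype.equivFinOfCardEq hcard)
  have h := Algebra.discr_of_matrix_vecMul (⇑b) (b.toMatrix v)
  rw [Module.Basis.toMatrix_map_vecMul, discr_eq_discr K b] at h
  rw [h] at hv ⊢
  rw [abs_mul]
  refine le_mul_of_one_le_left (abs_nonneg _) ?_
  exact Int.one_le_abs (left_ne_zero_of_mul hv)

theorem exists_powerBasis_fin_three (htop : IntermediateField.adjoin ℚ {(θ : K)} = ⊤)
    (hK : Module.finrank ℚ K = 3) :
    ∃ b : Module.Basis (Fin 3) ℚ K, ∀ i, b i = (θ : K) ^ (i : ℕ) := by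
  have hdeg := (Field.primitive_element_iff_minpoly_natDegree_eq ℚ (θ : K)).1 htop
  rw [hK] at hdeg
  have hli : LinearIndependent ℚ fun i : Fin 3 => (θ : K) ^ (i : ℕ) := by
    have := linearIndependent_pow (K := ℚ) (θ : K)
    rwa [hdeg] at this
  exact ⟨basisOfLinearIndependentOfCardEqFinrank hli (by simp [hK]), fun i => by simp⟩

theorem exists_eq_add_mul_add_mul_sq (htop : IntermediateField.adjoin ℚ {(θ : K)} = ⊤)
    (hK : Module.finrank ℚ K = 3) (x : K) :
    ∃ u v w : ℚ, x = u + v * θ + w * θ ^ 2 := by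
  obtain ⟨b, hb⟩ := exists_powerBasis_fin_three htop hK
  refine ⟨b.repr x 0, b.repr x 1, b.repr x 2, ?_⟩
  conv_lhs => rw [← b.sum_repr x]
  simp [Fin.sum_univ_three, hb, Algebra.smul_def]

theorem eq_zero_of_add_mul_add_mul_sq_eq_zero
    (htop : IntermediateField.adjoin ℚ {(θ : K)} = ⊤) (hK : Module.finrank ℚ K = 3)
    {u v w : ℤ} (h : (u + v * θ + w * θ ^ 2 : K) = 0) : u = 0 ∧ v = 0 ∧ w = 0 := by
  obtain ⟨b, hb⟩ := exists_powerBasis_fin_three htop hK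
  have h1 := Fintype.linearIndependent_iff.1 b.linearIndependent ![(u : ℚ), v, w] (by
    simpa [Fin.sum_univ_three, hb, Algebra.smul_def] using h)
  have h2 := h1 0
  have h3 := h1 1
  have h4 := h1 2
  simp at h2 h3 h4
  exact ⟨h2, h3, h4⟩

theorem exists_basis_leftMulMatrix (hθ : θ ^ 3 = a)
    (htop : IntermediateField.adjoin ℚ {(θ : K)} = ⊤) (hK : Module.finrank ℚ K = 3) :
    ∃ b : Module.Basis (Fin 3) ℚ K, ∀ u v w : ℚ,
      Algebra.leftMulMatrix b (u + v * θ + w * θ ^ 2) =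
        !![u, a * w, a * v; v, u, a * w; w, v, u] := by
  obtain ⟨b, hb⟩ := exists_powerBasis_fin_three htop hK
  have hθ' : (θ : K) ^ 3 = (a : ℚ) • b 0 := by
    rw [hb, Algebra.smul_def]
    simpa using congrArg (algebraMap (𝓞 K) K) hθ
  have hM : Algebra.leftMulMatrix b (θ : K) = !![0, 0, (a : ℚ); 1, 0, 0; 0, 1, 0] := by
    have h0 : (θ : K) * b 0 = b 1 := by simp [hb]
    have h1 : (θ : K) * b 1 = b 2 := by simp [hb]; ring
    have h2 : (θ : K) * b 2 = (a : ℚ) • b 0 := by rw [← hθ', hb]; simp; ring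
    ext i j
    rw [Algebra.leftMulMatrix_eq_repr_mul]
    fin_cases j
    · simp only [Fin.zero_eta, h0, b.repr_self]
      fin_cases i <;> simp
    · simp only [Fin.mk_one, h1, b.repr_self]
      fin_cases i <;> simp
    · simp only [Fin.reduceFinMk, h2, map_smul, b.repr_self]
      fin_cases i <;> simp
  refine ⟨b, fun u v w => ?_⟩
  have h1 : ((u : K) + v * θ + w * θ ^ 2) = algebraMap ℚ K u + v • (θ : K) + w • (θ : K) ^ 2 := by
    simp [Algebra.smul_def]
  rw [h1, map_add, map_add, map_smul, map_smul, map_pow, hM, AlgHom.commutes,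
    Algebra.algebraMap_eq_smul_one]
  ext i j
  fin_cases i <;> fin_cases j <;> simp [pow_two] <;> ring

theorem trace_add_mul_add_mul_sq (hθ : θ ^ 3 = a)
    (htop : IntermediateField.adjoin ℚ {(θ : K)} = ⊤) (hK : Module.finrank ℚ K = 3) (u v w : ℚ) :
    Algebra.trace ℚ K (u + v * θ + w * θ ^ 2) = 3 * u := by
  obtain ⟨b, hb⟩ := exists_basis_leftMulMatrix hθ htop hK
  rw [Algebra.trace_eq_matrix_trace b, hb, Matrix.trace_fin_three]
  simp
  ring

theorem norm_add_mul_add_mul_sq (hθ : θ ^ 3 = a)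
    (htop : IntermediateField.adjoin ℚ {(θ : K)} = ⊤) (hK : Module.finrank ℚ K = 3) (u v w : ℚ) :
    Algebra.norm ℚ (u + v * θ + w * θ ^ 2 : K) =
      u ^ 3 + a * v ^ 3 + a ^ 2 * w ^ 3 - 3 * a * u * v * w := by
  obtain ⟨b, hb⟩ := exists_basis_leftMulMatrix hθ htop hK
  rw [Algebra.norm_eq_matrix_det b, hb, Matrix.det_fin_three]
  simp
  ring

theorem abs_discr_le_of_pure_cubic (ha : a ≠ 0) (hθ : θ ^ 3 = a)
    (htop : IntermediateField.adjoin ℚ {(θ : K)} = ⊤) (hK : Module.finrank ℚ K = 3) :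
    |discr K| ≤ 27 * a ^ 2 := by
  have hθ' : (θ : K) ^ 3 = a := by simpa using congrArg (algebraMap (𝓞 K) K) hθ
  have htr : ∀ (z : 𝓞 K) (u v w : ℤ), (z : K) = u + v * θ + w * θ ^ 2 →
      Algebra.trace ℤ (𝓞 K) z = 3 * u := fun z u v w hz => by
    have := trace_add_mul_add_mul_sq hθ htop hK u v w
    push_cast at this
    rw [← hz, ← Algebra.coe_trace_int] at this
    exact_mod_cast this
  have hdisc : Algebra.discr ℤ (fun i : Fin 3 => θ ^ (i : ℕ)) = -27 * a ^ 2 := by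
    have h0 := htr 1 1 0 0 (by simp)
    have h1 := htr θ 0 1 0 (by simp)
    have h2 := htr (θ ^ 2) 0 0 1 (by simp)
    have h3 := htr (θ ^ 3) a 0 0 (by simp [hθ'])
    have h4 := htr (θ ^ 4) 0 a 0 (by push_cast; rw [← hθ']; ring)
    rw [Algebra.discr_def, Matrix.det_fin_three]
    simp only [Algebra.traceMatrix_apply, Algebra.traceForm_apply, ← pow_add]
    norm_num [h0, h1, h2, h3, h4]
    ring
  have hne : Algebra.discr ℤ (fun i : Fin 3 => θ ^ (i : ℕ)) ≠ 0 := by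
    rw [hdisc]
    positivity
  refine (abs_discr_le_abs_discr_of_ne_zero hK hne).trans ?_
  rw [hdisc, abs_mul, abs_of_nonneg (by positivity : (0 : ℤ) ≤ a ^ 2)]
  simp

theorem exists_three_mul_eq (hsq : Squarefree a) (hθ : θ ^ 3 = a)
    (htop : IntermediateField.adjoin ℚ {(θ : K)} = ⊤) (hK : Module.finrank ℚ K = 3) (x : 𝓞 K) :
    ∃ u v w : ℤ, 3 * x = u + v * θ + w * θ ^ 2 := by
  have hθ' : (θ : K) ^ 3 = a := by simpa using congrArg (algebraMap (𝓞 K) K) hθ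
  have ha : a ≠ 0 := hsq.ne_zero
  obtain ⟨u, v, w, hx⟩ := exists_eq_add_mul_add_mul_sq htop hK (x : K)
  have h0 := trace_add_mul_add_mul_sq hθ htop hK u v w
  have h1 := trace_add_mul_add_mul_sq hθ htop hK (a * w) u v
  have h2 := trace_add_mul_add_mul_sq hθ htop hK (a * v) (a * w) u
  have e1 : ((a * w : ℚ) + u * θ + v * θ ^ 2 : K) = ((x * θ : 𝓞 K) : K) := by
    rw [show ((x * θ : 𝓞 K) : K) = x * θ from rfl, hx]
    push_cast
    rw [← hθ']
    ring
  have e2 : ((a * v : ℚ) + (a * w : ℚ) * θ + u * θ ^ 2 : K) = ((x * θ ^ 2 : 𝓞 K) : K) := by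
    rw [show ((x * θ ^ 2 : 𝓞 K) : K) = x * θ ^ 2 from rfl, hx]
    push_cast
    rw [← hθ']
    ring
  rw [← hx, ← Algebra.coe_trace_int] at h0
  rw [e1, ← Algebra.coe_trace_int] at h1
  rw [e2, ← Algebra.coe_trace_int] at h2
  set U := Algebra.trace ℤ (𝓞 K) x
  set W := Algebra.trace ℤ (𝓞 K) (x * θ)
  set V := Algebra.trace ℤ (𝓞 K) (x * θ ^ 2)
  have h3 := norm_add_mul_add_mul_sq hθ htop hK 0 (3 * v) (3 * w)
  have e3 : ((0 : ℚ) + (3 * v : ℚ) * θ + (3 * w : ℚ) * θ ^ 2 : K) =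
      ((3 * x - (U : 𝓞 K) : 𝓞 K) : K) := by
    have : (U : K) = ((3 * u : ℚ) : K) := by rw [← h0]; simp
    rw [show ((3 * x - (U : 𝓞 K) : 𝓞 K) : K) = 3 * (x : K) - U by simp [map_ofNat], hx, this]
    push_cast
    ring
  rw [e3, ← Algebra.coe_norm_int] at h3
  set n := Algebra.norm ℤ (3 * x - (U : 𝓞 K))
  have haQ : (a : ℚ) ≠ 0 := by exact_mod_cast ha
  have h4 : (a : ℤ) ^ 2 * n = V ^ 3 + a * W ^ 3 := by
    have : (a : ℚ) ^ 2 * n = (V : ℚ) ^ 3 + a * (W : ℚ) ^ 3 := by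
      rw [h3, h1, h2]
      ring
    exact_mod_cast this
  have hsqZ : Squarefree (a : ℤ) := Int.squarefree_natCast.2 hsq
  have haZ : (a : ℤ) ≠ 0 := by exact_mod_cast ha
  obtain ⟨V', hV⟩ : (a : ℤ) ∣ V :=
    (hsqZ.dvd_pow_iff_dvd three_ne_zero).1 ⟨a * n - W ^ 3, by linear_combination -h4⟩
  obtain ⟨W', hW⟩ : (a : ℤ) ∣ W := by
    refine (hsqZ.dvd_pow_iff_dvd three_ne_zero).1 ⟨n - a * V' ^ 3, ?_⟩
    refine mul_left_cancel₀ haZ ?_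
    rw [hV] at h4
    linear_combination -h4
  refine ⟨U, V', W', RingOfIntegers.ext ?_⟩
  have hv : (V' : ℚ) = 3 * v := by
    refine mul_left_cancel₀ haQ ?_
    rw [hV] at h2
    push_cast at h2
    linear_combination h2
  have hw : (W' : ℚ) = 3 * w := by
    refine mul_left_cancel₀ haQ ?_
    rw [hW] at h1
    push_cast at h1
    linear_combination h1
  have hUK : (U : K) = 3 * u := by simpa using congrArg (algebraMap ℚ K) h0
  have hVK : (V' : K) = 3 * v := by simpa using congrArg (algebraMap ℚ K) hv
  have hWK : (W' : K) = 3 * w := by simpa using congrArg (algebraMap ℚ K) hw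
  simp only [map_add, map_mul, map_pow, map_ofNat, map_intCast]
  change (3 * x : K) = U + V' * θ + W' * θ ^ 2
  rw [hx, hUK, hVK, hWK]
  ring

theorem exists_cube_modEq {p ℓ : ℕ} (hp : p.Prime) (hp3 : p % 3 = 2) (hℓ : 0 < ℓ)
    (hpa : ¬ p ∣ a) : ∃ r : ℕ, ((p : ℤ) ^ ℓ) ∣ a - (r : ℤ) ^ 3 := by
  have hq : 0 < p ^ ℓ := pow_pos hp.pos ℓ
  have : NeZero (p ^ ℓ) := ⟨hq.ne'⟩
  have hcop : (Nat.card (ZMod (p ^ ℓ))ˣ).Coprime 3 := by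
    rw [Nat.card_eq_fintype_card, ZMod.card_units_eq_totient, Nat.totient_prime_pow hp hℓ]
    refine Nat.Coprime.mul_left (Nat.Coprime.pow_left _ ?_) ?_
    · rw [Nat.coprime_comm, Nat.Prime.coprime_iff_not_dvd Nat.prime_three]
      omega
    · rw [Nat.coprime_comm, Nat.Prime.coprime_iff_not_dvd Nat.prime_three]
      have := hp.two_le
      omega
  have hua : a.Coprime (p ^ ℓ) :=
    (Nat.Coprime.pow_left ℓ ((Nat.Prime.coprime_iff_not_dvd hp).2 hpa)).symm
  obtain ⟨s, hs⟩ := (powCoprime hcop).surjective (ZMod.unitOfCoprime a hua)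
  have hs' : ((s : ZMod (p ^ ℓ))) ^ 3 = a := by
    simpa using congrArg Units.val hs
  refine ⟨(s : ZMod (p ^ ℓ)).val, ?_⟩
  have h := (ZMod.intCast_eq_intCast_iff_dvd_sub (((s : ZMod (p ^ ℓ)).val : ℤ) ^ 3) a (p ^ ℓ)).1
    (by simp [hs'])
  exact_mod_cast h

theorem Ideal.IsPrime.dvd_of_intCast_mem {R : Type*} [CommRing R] {P : Ideal R}
    (hP : P.IsPrime) {p : ℕ} (hp : p.Prime) (hpP : (p : R) ∈ P) {n : ℤ} (hn : (n : R) ∈ P) :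
    (p : ℤ) ∣ n := by
  by_contra h
  have hc : IsCoprime (p : ℤ) n :=
    (Prime.coprime_iff_not_dvd (Nat.prime_iff_prime_int.1 hp)).2 h
  obtain ⟨s, t, hst⟩ := hc
  refine hP.ne_top ((Ideal.eq_top_iff_one P).2 ?_)
  have : (1 : R) = s * p + t * n := by exact_mod_cast congrArg (Int.cast : ℤ → R) hst.symm
  rw [this]
  exact P.add_mem (P.mul_mem_left _ hpP) (P.mul_mem_left _ hn)

theorem exists_prime_ideal_sub_mem_pow (hsq : Squarefree a) (hθ : θ ^ 3 = a)
    (htop : IntermediateField.adjoin ℚ {(θ : K)} = ⊤) (hK : Module.finrank ℚ K = 3)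
    {p ℓ : ℕ} (hp : p.Prime) (hp3 : p % 3 = 2) (hℓ : 0 < ℓ) (hpa : ¬ p ∣ a) :
    ∃ (P : Ideal (𝓞 K)) (r : ℤ), P.IsPrime ∧ (p : 𝓞 K) ∈ P ∧ θ - r ∈ P ^ ℓ ∧
      Ideal.absNorm P = p := by
  obtain ⟨r, hr⟩ := exists_cube_modEq hp hp3 hℓ hpa
  have hpr : (p : ℤ) ∣ a - (r : ℤ) ^ 3 := (dvd_pow_self _ hℓ.ne').trans hr
  have hp3' : ¬ (p : ℤ) ∣ 3 := fun h => by
    have h1 : p ∣ 3 := by exact_mod_cast h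
    rw [Nat.prime_dvd_prime_iff_eq hp Nat.prime_three] at h1
    omega
  have hfac : (θ - (r : ℤ)) * (θ ^ 2 + (r : ℤ) * θ + (r : ℤ) ^ 2) =
      ((a - (r : ℤ) ^ 3 : ℤ) : 𝓞 K) := by
    push_cast
    linear_combination hθ
  have hJ : Ideal.span {(p : 𝓞 K), θ - (r : ℤ)} ≠ ⊤ := by
    intro h
    obtain ⟨x, y, hxy⟩ := Ideal.mem_span_pair.1 ((Ideal.eq_top_iff_one _).1 h)
    obtain ⟨k, hk⟩ := hpr
    rw [hk] at hfac
    obtain ⟨u, v, w, h3⟩ := exists_three_mul_eq hsq hθ htop hK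
      (x * (θ ^ 2 + (r : ℤ) * θ + (r : ℤ) ^ 2) + y * k)
    have h4 : (3 * r ^ 2 - p * u : ℤ) + (3 * r - p * v : ℤ) * θ + (3 - p * w : ℤ) * θ ^ 2 = 0 := by
      push_cast at hfac hxy h3 ⊢
      linear_combination 3 * y * hfac - 3 * (θ ^ 2 + r * θ + r ^ 2) * hxy + p * h3
    have h5 : ((3 * r ^ 2 - p * u : ℤ) + (3 * r - p * v : ℤ) * θ + (3 - p * w : ℤ) * θ ^ 2 : K) =
        0 := by
      have := congrArg (algebraMap (𝓞 K) K) h4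
      simpa only [map_add, map_mul, map_pow, map_intCast, map_zero] using this
    have h6 := (eq_zero_of_add_mul_add_mul_sq_eq_zero htop hK h5).2.2
    exact hp3' ⟨w, by linarith⟩
  obtain ⟨P, hPmax, hJP⟩ := Ideal.exists_le_maximal _ hJ
  have hpP : (p : 𝓞 K) ∈ P := hJP (Ideal.subset_span (by simp))
  have hrP : θ - (r : ℤ) ∈ P := hJP (Ideal.subset_span (by simp))
  have hP := hPmax.isPrime
  refine ⟨P, r, hP, hpP, ?_, ?_⟩
  · obtain ⟨k, hk⟩ := hr
    have hmem : (θ ^ 2 + (r : ℤ) * θ + (r : ℤ) ^ 2) * (θ - (r : ℤ)) ∈ P ^ ℓ := by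
      rw [mul_comm, hfac, hk]
      push_cast
      exact Ideal.mul_mem_right _ _ (Ideal.pow_mem_pow hpP ℓ)
    refine (Ideal.IsPrime.mul_mem_pow P hmem).resolve_left fun h => ?_
    have h3 : ((3 * (r : ℤ) ^ 2 : ℤ) : 𝓞 K) ∈ P := by
      have : ((3 * (r : ℤ) ^ 2 : ℤ) : 𝓞 K) = (θ ^ 2 + (r : ℤ) * θ + (r : ℤ) ^ 2) -
          (θ + 2 * (r : ℤ)) * (θ - (r : ℤ)) := by
        push_cast
        ring
      rw [this]
      exact P.sub_mem h (P.mul_mem_left _ hrP)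
    have h4 := hP.dvd_of_intCast_mem hp hpP h3
    have hpZ := Nat.prime_iff_prime_int.1 hp
    have h5 := hpZ.dvd_of_dvd_pow ((hpZ.dvd_or_dvd h4).resolve_left hp3')
    refine hpa ?_
    have h6 := dvd_add hpr (h5.pow three_ne_zero)
    rw [sub_add_cancel] at h6
    exact_mod_cast h6
  · rw [Ideal.absNorm_apply, Submodule.cardQuot_apply]
    have : Fact p.Prime := ⟨hp⟩
    have : CharP (𝓞 K ⧸ P) p := (CharP.charP_iff_prime_eq_zero hp).2 (by
      rw [← map_natCast (Ideal.Quotient.mk P), Ideal.Quotient.eq_zero_iff_mem]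
      exact hpP)
    have hbij : Function.Bijective (ZMod.castHom (dvd_refl p) (𝓞 K ⧸ P)) := by
      refine ⟨RingHom.injective _, fun z => ?_⟩
      obtain ⟨x, rfl⟩ := Ideal.Quotient.mk_surjective z
      obtain ⟨u, v, w, h3⟩ := exists_three_mul_eq hsq hθ htop hK x
      obtain ⟨s, t, hst⟩ : IsCoprime (p : ℤ) 3 :=
        (Prime.coprime_iff_not_dvd (Nat.prime_iff_prime_int.1 hp)).2 hp3'
      refine ⟨((t * (u + v * r + w * r ^ 2) : ℤ) : ZMod p), ?_⟩
      rw [map_intCast, ← map_intCast (Ideal.Quotient.mk P), eq_comm, Ideal.Quotient.eq]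
      have hst' : (s * p + t * 3 : 𝓞 K) = 1 := by
        exact_mod_cast congrArg (Int.cast : ℤ → 𝓞 K) hst
      have : x - ((t * (u + v * r + w * r ^ 2) : ℤ) : 𝓞 K) =
          s * x * p + t * (v + w * (θ + r)) * (θ - (r : ℤ)) := by
        push_cast
        linear_combination t * h3 - x * hst'
      rw [this]
      exact P.add_mem (P.mul_mem_left _ hpP) (P.mul_mem_left _ hrP)
    rw [← Nat.card_congr (Equiv.ofBijective _ hbij), Nat.card_zmod]

theorem abs_trace_cube_le {x : K} {B : ℝ} (hK : Module.finrank ℚ K = 3)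
    (h : ∀ w : InfinitePlace K, w x ^ 3 ≤ B) :
    |(Algebra.trace ℚ K x : ℝ)| ^ 3 ≤ 27 * B := by
  have hB : 0 ≤ B := (pow_nonneg (apply_nonneg _ _) 3).trans (h (Classical.arbitrary _))
  have hB3 : (B ^ (1 / 3 : ℝ)) ^ 3 = B := by
    rw [← Real.rpow_natCast, ← Real.rpow_mul hB]
    norm_num
  have h1 : ∀ σ : K →ₐ[ℚ] ℂ, ‖σ x‖ ≤ B ^ (1 / 3 : ℝ) := fun σ => by
    refine le_of_pow_le_pow_left₀ three_ne_zero (by positivity) ?_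
    rw [hB3]
    exact h (InfinitePlace.mk σ.toRingHom)
  have h2 : |(Algebra.trace ℚ K x : ℝ)| ≤ 3 * B ^ (1 / 3 : ℝ) := by
    have h3 := trace_eq_sum_embeddings (K := ℚ) ℂ (x := x)
    have h4 : ‖algebraMap ℚ ℂ (Algebra.trace ℚ K x)‖ = |(Algebra.trace ℚ K x : ℝ)| := by
      simp
    rw [← h4, h3]
    refine (norm_sum_le_of_le _ fun σ _ => h1 σ).trans ?_
    rw [Finset.sum_const, Finset.card_univ, AlgHom.card, hK, nsmul_eq_mul]
    simp
  calc |(Algebra.trace ℚ K x : ℝ)| ^ 3 ≤ (3 * B ^ (1 / 3 : ℝ)) ^ 3 := by gcongr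
    _ = 27 * B := by rw [mul_pow, hB3]; norm_num

theorem infinitePlace_natCast {L : Type*} [Field L] (σ : InfinitePlace L) (n : ℕ) :
    σ (n : L) = n := by
  rw [← InfinitePlace.norm_embedding_eq, map_natCast]
  simp

theorem coeff_cube_le_of_forall_infinitePlace_cube_le (ha : 0 < a) (hθ : θ ^ 3 = a)
    (htop : IntermediateField.adjoin ℚ {(θ : K)} = ⊤) (hK : Module.finrank ℚ K = 3)
    {x : K} {u v w : ℚ} (hx : x = u + v * θ + w * θ ^ 2) {B : ℝ}
    (hB : ∀ σ : InfinitePlace K, σ x ^ 3 ≤ B) :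
    a * |(v : ℝ)| ^ 3 ≤ B ∧ a ^ 2 * |(w : ℝ)| ^ 3 ≤ B := by
  have hθ' : (θ : K) ^ 3 = a := by simpa using congrArg (algebraMap (𝓞 K) K) hθ
  have hwθ : ∀ σ : InfinitePlace K, σ θ ^ 3 = a := fun σ => by
    rw [← map_pow, hθ', infinitePlace_natCast]
  have haR : (0 : ℝ) < a := by exact_mod_cast ha
  have key : ∀ {z : ℚ} {n : ℕ}, Algebra.trace ℚ K (x * θ ^ n) = 3 * (a * z) →
      a ^ 3 * |(z : ℝ)| ^ 3 ≤ B * a ^ n := fun {z n} h => by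
    have h5 := abs_trace_cube_le hK (x := x * θ ^ n) (B := B * a ^ n) fun σ => by
      rw [map_mul, map_pow, mul_pow, pow_right_comm, hwθ]
      have := hB σ
      gcongr
    rw [h] at h5
    push_cast at h5
    rw [abs_mul, abs_mul, abs_of_pos haR, abs_of_pos (three_pos (α := ℝ)), mul_pow, mul_pow] at h5
    linarith
  constructor
  · have h1 := trace_add_mul_add_mul_sq hθ htop hK (a * v) (a * w) u
    have e1 : ((a * v : ℚ) + (a * w : ℚ) * θ + u * θ ^ 2 : K) = x * θ ^ 2 := by
      push_cast
      rw [hx, ← hθ']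
      ring
    rw [e1] at h1
    refine le_of_mul_le_mul_right ?_ (pow_pos haR 2)
    linarith [key h1]
  · have h1 := trace_add_mul_add_mul_sq hθ htop hK (a * w) u v
    have e1 : ((a * w : ℚ) + u * θ + v * θ ^ 2 : K) = x * θ ^ 1 := by
      push_cast
      rw [hx, ← hθ']
      ring
    rw [e1] at h1
    refine le_of_mul_le_mul_right ?_ (pow_pos haR 1)
    linarith [key h1]

theorem Ideal.IsPrime.eq_of_span_mul_pow_eq {P Q : Ideal (𝓞 K)} (hP : P.IsPrime)
    (hQ : Q.IsPrime) (hQ0 : Q ≠ ⊥) {ℓ : ℕ} (hℓ : ℓ ≠ 0) {m n x y : 𝓞 K} (hm : m ∉ P) (hy : y ≠ 0)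
    (hxy : Ideal.span {x} * P ^ ℓ = Ideal.span {y} * Q ^ ℓ) (h : m * x = n * y) : P = Q := by
  have h9 : Ideal.span {m} * Q ^ ℓ = Ideal.span {n} * P ^ ℓ := by
    have hy0 : Ideal.span {y} ≠ ⊥ := by simpa using hy
    refine mul_left_cancel₀ hy0 ?_
    calc Ideal.span {y} * (Ideal.span {m} * Q ^ ℓ)
        = Ideal.span {m} * (Ideal.span {y} * Q ^ ℓ) := by ring
      _ = Ideal.span {m * x} * P ^ ℓ := by
        rw [← hxy, ← mul_assoc, Ideal.span_singleton_mul_span_singleton]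
      _ = Ideal.span {y} * (Ideal.span {n} * P ^ ℓ) := by
        rw [h, ← Ideal.span_singleton_mul_span_singleton]
        ring
  have h10 : Ideal.span {m} * Q ^ ℓ ≤ P :=
    h9.le.trans (Ideal.mul_le_right.trans (Ideal.pow_le_self hℓ))
  have h11 := (hP.mul_le.1 h10).resolve_left fun h11 =>
    hm (h11 (Ideal.mem_span_singleton_self _))
  exact ((hQ.isMaximal hQ0).eq_of_le hP.ne_top (hP.le_of_pow_le h11)).symm

theorem eq_of_span_mul_pow_eq (hsq : Squarefree a) (hθ : θ ^ 3 = a)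
    (htop : IntermediateField.adjoin ℚ {(θ : K)} = ⊤) (hK : Module.finrank ℚ K = 3)
    {p q ℓ : ℕ} (hp : p.Prime) (hp3 : p % 3 = 2) (hq : q.Prime)
    {P Q : Ideal (𝓞 K)} (hP : P.IsPrime) (hQ : Q.IsPrime) (hpP : (p : 𝓞 K) ∈ P)
    (hqQ : (q : 𝓞 K) ∈ Q) (hℓ : 0 < ℓ) {r : ℤ} (hr : θ - r ∈ P ^ ℓ)
    (h₁ : 81 * ((p ^ ℓ) ^ 2 * q ^ ℓ) < a ^ 2) (h₂ : 81 * q ^ ℓ < a * p ^ ℓ) {x y : 𝓞 K}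
    (hy : y ≠ 0) (hxy : Ideal.span {x} * P ^ ℓ = Ideal.span {y} * Q ^ ℓ)
    (hw : ∀ w : InfinitePlace K, w x ^ 3 * (p : ℝ) ^ ℓ ≤ 3 * (w y ^ 3 * (q : ℝ) ^ ℓ)) :
    P = Q := by
  have hθ' : (θ : K) ^ 3 = a := by simpa using congrArg (algebraMap (𝓞 K) K) hθ
  have ha : 0 < a := Nat.pos_of_ne_zero hsq.ne_zero
  have hpos : 0 < p ^ ℓ := pow_pos hp.pos ℓ
  have hdiv : ∀ z ∈ P ^ ℓ, ∃ t : 𝓞 K, z * x = y * t := fun z hz => by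
    have : z * x ∈ Ideal.span {y} * Q ^ ℓ := by
      rw [← hxy, mul_comm z]
      exact Ideal.mul_mem_mul (Ideal.mem_span_singleton_self x) hz
    exact Ideal.mem_span_singleton.1 (Ideal.mul_le_left this)
  obtain ⟨β, hβ⟩ := hdiv _ (Ideal.pow_mem_pow hpP ℓ)
  obtain ⟨δ, hδ⟩ := hdiv _ hr
  have hβδ : (θ - r) * β = p ^ ℓ * δ := by
    refine mul_left_cancel₀ hy ?_
    linear_combination p ^ ℓ * hδ - (θ - r) * hβ
  obtain ⟨u, v, w, h3⟩ := exists_three_mul_eq hsq hθ htop hK β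
  have hwβ : ∀ σ : InfinitePlace K, σ β ^ 3 ≤ 3 * ((p ^ ℓ : ℝ) ^ 2 * q ^ ℓ) := fun σ => by
    have hσy : 0 < σ (y : K) := InfinitePlace.pos_iff.2 (by simpa using hy)
    have h4 : (p : ℝ) ^ ℓ * σ (x : K) = σ (y : K) * σ (β : K) := by
      have := congrArg (fun z : 𝓞 K => σ (algebraMap (𝓞 K) K z)) hβ
      simpa only [map_mul, map_pow, map_natCast, infinitePlace_natCast] using this
    refine le_of_mul_le_mul_left ?_ (pow_pos hσy 3)
    have h5 := mul_le_mul_of_nonneg_left (hw σ) (by positivity : (0 : ℝ) ≤ (p ^ ℓ) ^ 2)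
    rw [← mul_pow, ← h4]
    linarith
  have h3K : (3 * β : K) = u + v * θ + w * θ ^ 2 := by
    have := congrArg (algebraMap (𝓞 K) K) h3
    simpa only [map_add, map_mul, map_pow, map_intCast, map_ofNat] using this
  have hσ3 : ∀ σ : InfinitePlace K, σ (3 : K) = 3 := fun σ => by
    simpa using infinitePlace_natCast σ 3
  have haR : (0 : ℝ) < a := by exact_mod_cast ha
  have hposR : (0 : ℝ) < p ^ ℓ := by exact_mod_cast hpos
  have hB : ∀ σ : InfinitePlace K, σ (3 * β : K) ^ 3 ≤ 81 * ((p ^ ℓ : ℝ) ^ 2 * q ^ ℓ) := fun σ => by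
    rw [map_mul, mul_pow, hσ3]
    linarith [hwβ σ]
  obtain ⟨hvB, hwB⟩ := coeff_cube_le_of_forall_infinitePlace_cube_le (u := u) (v := v) (w := w) ha
    hθ htop hK (by exact_mod_cast h3K) hB
  have hw0 : w = 0 := by
    have h6 : (81 * ((p ^ ℓ : ℝ) ^ 2 * q ^ ℓ)) < a ^ 2 := by exact_mod_cast h₁
    have h7 : |(w : ℝ)| ^ 3 < 1 ^ 3 := by
      refine lt_of_mul_lt_mul_left ?_ (by positivity : (0 : ℝ) ≤ a ^ 2)
      have := hwB.trans_lt h6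
      push_cast at this
      linarith
    exact Int.abs_lt_one_iff.1 (by exact_mod_cast lt_of_pow_lt_pow_left₀ 3 zero_le_one h7)
  subst hw0
  obtain ⟨u', v', w', h3'⟩ := exists_three_mul_eq hsq hθ htop hK δ
  have h4 : ((-(r * u) - p ^ ℓ * u' : ℤ) + (u - r * v - p ^ ℓ * v' : ℤ) * θ +
      (v - p ^ ℓ * w' : ℤ) * θ ^ 2 : 𝓞 K) = 0 := by
    push_cast at h3 ⊢
    linear_combination 3 * hβδ - (θ - r) * h3 + p ^ ℓ * h3'
  have h5 : ((-(r * u) - p ^ ℓ * u' : ℤ) + (u - r * v - p ^ ℓ * v' : ℤ) * θ +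
      (v - p ^ ℓ * w' : ℤ) * θ ^ 2 : K) = 0 := by
    have := congrArg (algebraMap (𝓞 K) K) h4
    simpa only [map_add, map_mul, map_pow, map_intCast, map_zero] using this
  obtain ⟨-, h6, h7⟩ := eq_zero_of_add_mul_add_mul_sq_eq_zero htop hK h5
  have hv0 : v = 0 := by
    have h8 : (81 * q ^ ℓ : ℝ) < a * p ^ ℓ := by exact_mod_cast h₂
    have h9 : |(v : ℝ)| ^ 3 < (p ^ ℓ) ^ 3 := by
      refine lt_of_mul_lt_mul_left ?_ haR.le
      push_cast at hvB
      have := mul_lt_mul_of_pos_left h8 (pow_pos hposR 2)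
      linarith
    have h10 := lt_of_pow_lt_pow_left₀ 3 hposR.le h9
    exact Int.eq_zero_of_abs_lt_dvd ⟨w', sub_eq_zero.1 h7⟩ (by exact_mod_cast h10)
  subst hv0
  have hu : u = p ^ ℓ * v' := by linarith
  have h8 : 3 * x = v' * y := by
    have hp0 : ((p : 𝓞 K)) ^ ℓ ≠ 0 := by exact_mod_cast hpos.ne'
    refine mul_left_cancel₀ hp0 ?_
    rw [hu] at h3
    push_cast at h3
    linear_combination 3 * hβ + y * h3
  have hQ0 : Q ≠ ⊥ := by
    rintro rfl
    exact hq.ne_zero (by simpa using hqQ)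
  refine hP.eq_of_span_mul_pow_eq hQ hQ0 hℓ.ne' (fun h9 => ?_) hy hxy h8
  have h10 : p ∣ 3 := by exact_mod_cast hP.dvd_of_intCast_mem hp hpP (n := 3) (by simpa using h9)
  rw [Nat.prime_dvd_prime_iff_eq hp Nat.prime_three] at h10
  omega

end PureCubicField

section Assembly

theorem card_primeFactors_le_log (a : ℕ) : a.primeFactors.card ≤ Nat.log 2 a := by
  rcases eq_or_ne a 0 with rfl | ha
  · simp
  refine Nat.le_log_of_pow_le one_lt_two ?_
  calc 2 ^ a.primeFactors.card ≤ ∏ p ∈ a.primeFactors, p :=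
        Finset.pow_card_le_prod _ _ _ fun p hp => (Nat.prime_of_mem_primeFactors hp).two_le
    _ ≤ a := Nat.le_of_dvd (Nat.pos_of_ne_zero ha) (Nat.prod_primeFactors_dvd a)

section

variable {K : Type*} [Field K] [NumberField K]

open nonZeroDivisors

theorem card_torsion_mul_card_le_real (hK : Module.finrank ℚ K = 3) {ℓ : ℕ} (hℓ : 0 < ℓ)
    (T : Finset (Ideal (𝓞 K))⁰)
    (hT : ∀ A ∈ T, ∀ B ∈ T, ∀ x y : 𝓞 K, x ≠ 0 → y ≠ 0 →
      Ideal.span {x} * (A : Ideal (𝓞 K)) ^ ℓ = Ideal.span {y} * (B : Ideal (𝓞 K)) ^ ℓ →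
      (∀ w : InfinitePlace K, w x ^ 3 * (Ideal.absNorm (A : Ideal (𝓞 K)) : ℝ) ^ ℓ ≤
        3 * (w y ^ 3 * (Ideal.absNorm (B : Ideal (𝓞 K)) : ℝ) ^ ℓ)) → A = B) :
    (Nat.card {c : ClassGroup (𝓞 K) // c ^ ℓ = 1} : ℝ) * T.card ≤
      16 * √|(discr K : ℝ)| * (1 + Real.log (16 * √|(discr K : ℝ)|)) ^ 2 *
        (3 * ℓ * Real.log (16 * √|(discr K : ℝ)|) + 1) ^ 3 := by
  have h := card_torsion_mul_card_le hK hℓ T hT (finite_setOf_absNorm_le_nat _)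
  set Y := 16 * √|(discr K : ℝ)| with hY
  have hD : (1 : ℝ) ≤ |(discr K : ℝ)| := by
    exact_mod_cast Int.one_le_abs (discr_ne_zero K)
  have hY1 : 1 ≤ Y := by
    have := Real.one_le_sqrt.2 hD
    linarith
  have hlog : 0 ≤ Real.log Y := Real.log_nonneg hY1
  have hfl : (⌊Y⌋₊ : ℝ) ≤ Y := Nat.floor_le (by linarith)
  have hfl1 : (1 : ℝ) ≤ ⌊Y⌋₊ := by
    exact_mod_cast Nat.le_floor (by simpa using hY1)
  have hlfl : 0 ≤ Real.log ⌊Y⌋₊ := Real.log_nonneg hfl1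
  have hbin : (⌊3 * ℓ * Real.log Y⌋₊ : ℝ) ≤ 3 * ℓ * Real.log Y := Nat.floor_le (by positivity)
  calc (Nat.card {c : ClassGroup (𝓞 K) // c ^ ℓ = 1} : ℝ) * T.card
      ≤ ({I : Ideal (𝓞 K) | I ≠ ⊥ ∧ Ideal.absNorm I ≤ ⌊Y⌋₊}.ncard : ℝ) *
        (⌊3 * ℓ * Real.log Y⌋₊ + 1) ^ 3 := by exact_mod_cast h
    _ ≤ (⌊Y⌋₊ * (1 + Real.log ⌊Y⌋₊) ^ 2) * (3 * ℓ * Real.log Y + 1) ^ 3 := by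
        gcongr
        exact ncard_absNorm_le hK _
    _ ≤ Y * (1 + Real.log Y) ^ 2 * (3 * ℓ * Real.log Y + 1) ^ 3 := by
        gcongr

variable {a : ℕ} {θ : 𝓞 K}

theorem card_torsion_mul_card_primes_le (hsq : Squarefree a) (hθ : θ ^ 3 = a)
    (htop : IntermediateField.adjoin ℚ {(θ : K)} = ⊤) (hK : Module.finrank ℚ K = 3)
    {ℓ : ℕ} (hℓ : 0 < ℓ) {N : ℕ} (h₁ : 81 * N ^ (3 * ℓ) < a ^ 2) (h₂ : 81 * N ^ ℓ < a) :
    (Nat.card {c : ClassGroup (𝓞 K) // c ^ ℓ = 1} : ℝ) *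
        ((primesTwoModThree N).card - Nat.log 2 a) ≤
      16 * √|(discr K : ℝ)| * (1 + Real.log (16 * √|(discr K : ℝ)|)) ^ 2 *
        (3 * ℓ * Real.log (16 * √|(discr K : ℝ)|) + 1) ^ 3 := by
  classical
  let S := (primesTwoModThree N).filter fun p => ¬ p ∣ a
  have hS : ∀ p : S, (p : ℕ).Prime ∧ (p : ℕ) % 3 = 2 ∧ (p : ℕ) ≤ N ∧ ¬ (p : ℕ) ∣ a := fun p => by
    have := p.2
    simp only [S, primesTwoModThree, Finset.mem_filter, Finset.mem_Ioc] at this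
    tauto
  choose P r hP hpP hr hnorm using fun p : S =>
    exists_prime_ideal_sub_mem_pow hsq hθ htop hK (hS p).1 (hS p).2.1 hℓ (hS p).2.2.2
  have hP0 : ∀ p, P p ≠ ⊥ := fun p h => (hS p).1.ne_zero (by rw [← hnorm p, h]; simp)
  let A : S → (Ideal (𝓞 K))⁰ := fun p => ⟨P p, mem_nonZeroDivisors_of_ne_zero (hP0 p)⟩
  have hA : Function.Injective A := fun p q hpq => Subtype.ext (by
    rw [← hnorm p, ← hnorm q]
    exact congrArg Ideal.absNorm (congrArg Subtype.val hpq))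
  have key := card_torsion_mul_card_le_real hK hℓ (Finset.univ.image A) (by
    intro B hB C hC x y _ hy hxy hw
    obtain ⟨p, -, rfl⟩ := Finset.mem_image.1 hB
    obtain ⟨q, -, rfl⟩ := Finset.mem_image.1 hC
    have hpos : 0 < (p : ℕ) ^ ℓ := pow_pos (hS p).1.pos ℓ
    refine Subtype.ext (eq_of_span_mul_pow_eq hsq hθ htop hK (hS p).1 (hS p).2.1 (hS q).1 (hP p)
      (hP q) (hpP p) (hpP q) hℓ (hr p) ?_ ?_ hy hxy fun w => ?_)
    · refine lt_of_le_of_lt ?_ h₁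
      calc 81 * (((p : ℕ) ^ ℓ) ^ 2 * (q : ℕ) ^ ℓ) ≤ 81 * ((N ^ ℓ) ^ 2 * N ^ ℓ) := by
            have h3 := (hS p).2.2.1
            have h4 := (hS q).2.2.1
            gcongr
        _ = 81 * N ^ (3 * ℓ) := by ring
    · calc 81 * (q : ℕ) ^ ℓ ≤ 81 * N ^ ℓ := by
            have h4 := (hS q).2.2.1
            gcongr
        _ < a := h₂
        _ ≤ a * (p : ℕ) ^ ℓ := Nat.le_mul_of_pos_right a hpos
    · have := hw w
      simp only [A, hnorm] at this
      exact this)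
  refine le_trans (mul_le_mul_of_nonneg_left ?_ (Nat.cast_nonneg _)) key
  rw [Finset.card_image_of_injective _ hA, Finset.card_univ, Fintype.card_coe, sub_le_iff_le_add]
  have h3 : (primesTwoModThree N).card ≤ S.card + Nat.log 2 a := by
    rw [← Finset.card_filter_add_card_filter_not (s := primesTwoModThree N) (fun p => ¬ p ∣ a)]
    refine Nat.add_le_add_left ((Finset.card_le_card ?_).trans (card_primeFactors_le_log a)) _
    intro p hp
    simp only [primesTwoModThree, Finset.mem_filter, Finset.mem_Ioc, not_not] at hp
    exact Nat.mem_primeFactors.2 ⟨hp.1.2.1, hp.2, hsq.ne_zero⟩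
  exact_mod_cast h3

end

theorem exists_mul_log_pow_le (ℓ : ℕ) {η : ℝ} (hη : 0 < η) :
    ∃ C : ℝ, 0 < C ∧ ∀ D : ℝ, 1 ≤ D →
      16 * √D * (1 + Real.log (16 * √D)) ^ 2 * (3 * ℓ * Real.log (16 * √D) + 1) ^ 3 ≤
        C * D ^ (1 / 2 + η) := by
  refine ⟨16 * (3 * ℓ + 1) ^ 3 * (4 + 5 / η) ^ 5, by positivity, fun D hD => ?_⟩
  have hD0 : 0 < D := by linarith
  have hpow : 1 ≤ D ^ (η / 5) := Real.one_le_rpow hD (by positivity)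
  have hlogD : Real.log D ≤ 5 / η * D ^ (η / 5) := by
    refine (Real.log_le_rpow_div hD0.le (by positivity : 0 < η / 5)).trans_eq ?_
    field_simp
  have hlog0 : 0 ≤ Real.log D := Real.log_nonneg hD
  have h16 : Real.log 16 ≤ 3 := by
    have : Real.log 16 = 4 * Real.log 2 := by
      rw [show (16 : ℝ) = 2 ^ 4 by norm_num, Real.log_pow]
      norm_num
    have := Real.log_two_lt_d9
    linarith
  have hlogY : Real.log (16 * √D) = Real.log 16 + Real.log D / 2 := by
    rw [Real.log_mul (by norm_num) (Real.sqrt_pos.2 hD0).ne', Real.log_sqrt hD0.le]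
  have hY0 : 0 ≤ Real.log (16 * √D) := by
    have := Real.log_nonneg (by norm_num : (1 : ℝ) ≤ 16)
    linarith
  set L := Real.log (16 * √D)
  have hL : 1 + L ≤ (4 + 5 / η) * D ^ (η / 5) := by
    rw [hlogY]
    nlinarith
  calc 16 * √D * (1 + L) ^ 2 * (3 * ℓ * L + 1) ^ 3
      ≤ 16 * √D * (1 + L) ^ 2 * ((3 * ℓ + 1) * (1 + L)) ^ 3 := by
        gcongr
        have : (0 : ℝ) ≤ 3 * ℓ := by positivity
        nlinarith
    _ = 16 * (3 * ℓ + 1) ^ 3 * √D * (1 + L) ^ 5 := by ring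
    _ ≤ 16 * (3 * ℓ + 1) ^ 3 * √D * ((4 + 5 / η) * D ^ (η / 5)) ^ 5 := by gcongr
    _ = 16 * (3 * ℓ + 1) ^ 3 * (4 + 5 / η) ^ 5 * (√D * (D ^ (η / 5)) ^ 5) := by ring
    _ = 16 * (3 * ℓ + 1) ^ 3 * (4 + 5 / η) ^ 5 * D ^ (1 / 2 + η) := by
        rw [Real.rpow_add hD0, ← Real.sqrt_eq_rpow, ← Real.rpow_mul_natCast hD0.le]
        congr 3
        push_cast
        ring

open Filter Asymptotics in
theorem eventually_exists_card_primesTwoModThree {ℓ : ℕ} (hℓ : 0 < ℓ) {δ : ℝ} (hδ : 0 < δ)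
    (hδ1 : δ < 1) :
    ∀ᶠ a : ℕ in atTop, ∃ N : ℕ, 81 * N ^ (3 * ℓ) < a ^ 2 ∧ 81 * N ^ ℓ < a ∧
      (a : ℝ) ^ (2 / (3 * ℓ) * (1 - δ)) / 24 ≤ (primesTwoModThree N).card - Nat.log 2 a := by
  have hℓ1 : (1 : ℝ) ≤ ℓ := by exact_mod_cast hℓ
  have hℓ0 : (0 : ℝ) < ℓ := by linarith
  set t : ℝ := 2 / (3 * ℓ) with ht
  have ht0 : 0 < t := by positivity
  have ht1 : t ≤ 1 := by
    rw [ht, div_le_one (by positivity)]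
    linarith
  have hs0 : 0 < t * (1 - δ) := mul_pos ht0 (by linarith)
  have hs1 : t * (1 - δ) ≤ 1 := by nlinarith
  obtain ⟨N₀, hN₀⟩ := exists_rpow_le_card_primesTwoModThree hδ
  have htend : Tendsto (fun a : ℕ => ((a : ℝ) / 12) ^ t) atTop atTop :=
    (tendsto_rpow_atTop ht0).comp (tendsto_natCast_atTop_atTop.atTop_div_const (by norm_num))
  have hlog : ∀ᶠ a : ℕ in atTop, Real.log a ≤ 1 / 48 * (a : ℝ) ^ (t * (1 - δ)) := by
    have := ((isLittleO_log_rpow_atTop hs0).comp_tendsto tendsto_natCast_atTop_atTop).bound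
      (by norm_num : (0 : ℝ) < 1 / 48)
    filter_upwards [this] with a h
    have h0 : (0 : ℝ) ≤ (a : ℝ) ^ (t * (1 - δ)) := by positivity
    simp only [Function.comp, Real.norm_eq_abs, abs_of_nonneg h0] at h
    exact (le_abs_self _).trans h
  filter_upwards [hlog, htend.eventually_ge_atTop 1,
    (tendsto_nat_floor_atTop.comp htend).eventually_ge_atTop N₀,
    eventually_gt_atTop 5000] with a hloga hge hN ha
  have haR : (5000 : ℝ) < a := by exact_mod_cast ha
  set z : ℝ := ((a : ℝ) / 12) ^ t with hz
  have hz0 : 0 ≤ z := by linarith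
  have hNz : (⌊z⌋₊ : ℝ) ≤ z := Nat.floor_le hz0
  have hN3 : (⌊z⌋₊ : ℝ) ^ (3 * ℓ) ≤ (a / 12) ^ 2 := by
    calc (⌊z⌋₊ : ℝ) ^ (3 * ℓ) ≤ z ^ (3 * ℓ) := by gcongr
      _ = (a / 12) ^ 2 := by
        rw [hz, ← Real.rpow_mul_natCast (by positivity), ← Real.rpow_natCast, ht]
        congr 1
        push_cast
        field_simp
  refine ⟨⌊z⌋₊, ?_, ?_, ?_⟩
  · have : (81 : ℝ) * (⌊z⌋₊ : ℝ) ^ (3 * ℓ) < a ^ 2 := by nlinarith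
    exact_mod_cast this
  · have : (81 : ℝ) * (⌊z⌋₊ : ℝ) ^ ℓ < a := by
      have h3 : ((81 : ℝ) * (⌊z⌋₊ : ℝ) ^ ℓ) ^ 3 = (81 : ℝ) ^ 3 * (⌊z⌋₊ : ℝ) ^ (3 * ℓ) := by
        rw [mul_pow, ← pow_mul, mul_comm ℓ]
      have h4 : (81 : ℝ) ^ 3 * ((a : ℝ) / 12) ^ 2 < (a : ℝ) ^ 3 := by
        have : (0 : ℝ) < (a : ℝ) ^ 2 := by positivity
        nlinarith
      refine lt_of_pow_lt_pow_left₀ 3 (by positivity) (lt_of_le_of_lt ?_ h4)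
      rw [h3]
      gcongr
    exact_mod_cast this
  · have h1 : z / 2 ≤ ⌊z⌋₊ := by
      have h2 := Nat.lt_floor_add_one z
      have h3 : (1 : ℝ) ≤ ⌊z⌋₊ := by
        exact_mod_cast Nat.le_floor (by simpa using hge)
      linarith
    have h2 : (1 / 2 : ℝ) ≤ (1 / 2 : ℝ) ^ (1 - δ) := by
      conv_lhs => rw [← Real.rpow_one (1 / 2 : ℝ)]
      exact Real.rpow_le_rpow_of_exponent_ge (by norm_num) (by norm_num) (by linarith)
    have h3 : (1 / 12 : ℝ) ≤ (1 / 12 : ℝ) ^ (t * (1 - δ)) := by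
      conv_lhs => rw [← Real.rpow_one (1 / 12 : ℝ)]
      exact Real.rpow_le_rpow_of_exponent_ge (by norm_num) (by norm_num) hs1
    have h4 : (a : ℝ) ^ (t * (1 - δ)) / 12 ≤ 2 * (⌊z⌋₊ : ℝ) ^ (1 - δ) := by
      calc (a : ℝ) ^ (t * (1 - δ)) / 12 = 1 / 12 * (a : ℝ) ^ (t * (1 - δ)) := by ring
        _ ≤ (1 / 12 : ℝ) ^ (t * (1 - δ)) * (a : ℝ) ^ (t * (1 - δ)) := by gcongr
        _ = z ^ (1 - δ) := by
          rw [← Real.mul_rpow (by norm_num) (by positivity), hz, ← Real.rpow_mul (by positivity)]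
          congr 1
          ring
        _ = 2 * (1 / 2 * z ^ (1 - δ)) := by ring
        _ ≤ 2 * ((1 / 2 : ℝ) ^ (1 - δ) * z ^ (1 - δ)) := by gcongr
        _ = 2 * (z / 2) ^ (1 - δ) := by
          rw [← Real.mul_rpow (by norm_num) hz0]
          ring_nf
        _ ≤ 2 * (⌊z⌋₊ : ℝ) ^ (1 - δ) := by
          gcongr
    have h5 : (Nat.log 2 a : ℝ) ≤ 2 * Real.log a := by
      have h6 : (Nat.log 2 a : ℝ) * Real.log 2 ≤ Real.log a := by
        rw [← Real.log_pow]
        refine Real.log_le_log (by positivity) ?_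
        exact_mod_cast Nat.pow_log_le_self 2 (by lia : a ≠ 0)
      have h7 := Real.log_two_gt_d9
      have h8 : (0 : ℝ) ≤ Nat.log 2 a := Nat.cast_nonneg _
      nlinarith
    have h6 := hN₀ _ hN
    simp only [Function.comp] at h6
    linarith

end Assembly

/-- torsion bound for pure cubic fields `K = ℚ(a^{1/3})` with `a` squarefree. -/
theorem torsion_pure_cubic_squarefree (ℓ : ℕ) (hℓ : 0 < ℓ) (ε : ℝ) (hε : 0 < ε) :
    ∃ C : ℝ, 0 < C ∧
      ∀ (K : Type) (_ : Field K) (_ : NumberField K) (a : ℕ) (θ : K),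
        Squarefree a → 1 < a →
        θ ^ 3 = (a : K) → IntermediateField.adjoin ℚ {θ} = ⊤ →
        Module.finrank ℚ K = 3 →
        (Nat.card {c : ClassGroup (𝓞 K) // c ^ ℓ = 1} : ℝ) ≤
          C * (DK K : ℝ) ^ ((1 : ℝ) / 2 - 1 / (3 * (ℓ : ℝ)) + ε) := by
  have hℓ1 : (1 : ℝ) ≤ ℓ := by exact_mod_cast hℓ
  have hℓ0 : (0 : ℝ) < ℓ := by linarith
  set δ : ℝ := min ε (1 / 2) with hδ
  have hδ0 : 0 < δ := lt_min hε (by norm_num)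
  have hδ1 : δ < 1 := (min_le_right _ _).trans_lt (by norm_num)
  have hδε : δ ≤ ε := min_le_left _ _
  obtain ⟨C₁, hC₁, hC⟩ := exists_mul_log_pow_le ℓ (half_pos hε)
  obtain ⟨a₀, ha₀⟩ := Filter.eventually_atTop.1
    (eventually_exists_card_primesTwoModThree hℓ hδ0 hδ1)
  set s : ℝ := 1 / (3 * ℓ) * (1 - δ) with hs
  have hs3 : 1 / (3 * (ℓ : ℝ)) ≤ 1 / 3 := by
    gcongr
    linarith
  have hs3' : 0 < 1 / (3 * (ℓ : ℝ)) := by positivity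
  have hs0 : 0 ≤ s := mul_nonneg hs3'.le (by linarith)
  have hs1 : s ≤ 1 := by nlinarith
  refine ⟨C₁ * (27 * a₀ ^ 2 + 1) ^ (1 / 2 + ε / 2) + 648 * C₁, by positivity,
    fun K _ _ a θ hsq _ hθ htop hK => ?_⟩
  have hθint : IsIntegral ℤ θ := by
    refine IsIntegral.of_pow three_pos ?_
    rw [hθ]
    simpa using isIntegral_algebraMap (R := ℤ) (A := K) (x := (a : ℤ))
  obtain ⟨θ, rfl⟩ : ∃ θ' : 𝓞 K, (θ' : K) = θ := ⟨⟨θ, hθint⟩, rfl⟩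
  have hθ' : θ ^ 3 = a := RingOfIntegers.ext (by simpa using hθ)
  have hD1 : (1 : ℝ) ≤ |(discr K : ℝ)| := by
    exact_mod_cast Int.one_le_abs (discr_ne_zero K)
  have hDa : |(discr K : ℝ)| ≤ 27 * a ^ 2 := by
    exact_mod_cast abs_discr_le_of_pure_cubic hsq.ne_zero hθ' htop hK
  have hDK : (DK K : ℝ) = |(discr K : ℝ)| := by
    rw [DK, Nat.cast_natAbs, Int.cast_abs]
  rw [hDK]
  set D := |(discr K : ℝ)|
  have hD0 : 0 < D := by linarith
  rcases lt_or_ge a a₀ with ha | ha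
  · have h := card_torsion_mul_card_le_real hK hℓ {1} (by simp)
    rw [Finset.card_singleton, Nat.cast_one, mul_one] at h
    have h1 : 1 ≤ D ^ (1 / 2 - 1 / (3 * (ℓ : ℝ)) + ε) := Real.one_le_rpow hD1 (by linarith)
    calc _ ≤ C₁ * D ^ (1 / 2 + ε / 2) := h.trans (hC D hD1)
      _ ≤ C₁ * (27 * a₀ ^ 2 + 1) ^ (1 / 2 + ε / 2) := by
        have : (a : ℝ) ≤ a₀ := by exact_mod_cast ha.le
        have : (a : ℝ) ^ 2 ≤ a₀ ^ 2 := by gcongr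
        gcongr
        linarith
      _ ≤ (C₁ * (27 * a₀ ^ 2 + 1) ^ (1 / 2 + ε / 2) + 648 * C₁) * 1 := by linarith
      _ ≤ _ := by gcongr
  · obtain ⟨N, hN₁, hN₂, hN⟩ := ha₀ a ha
    have h := (card_torsion_mul_card_primes_le hsq hθ' htop hK hℓ hN₁ hN₂).trans (hC D hD1)
    have h1 : D ^ s / 648 ≤ (a : ℝ) ^ (2 / (3 * ℓ) * (1 - δ)) / 24 := by
      have h2 : (1 / 27 : ℝ) ≤ (1 / 27 : ℝ) ^ s := by
        conv_lhs => rw [← Real.rpow_one (1 / 27 : ℝ)]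
        exact Real.rpow_le_rpow_of_exponent_ge (by norm_num) (by norm_num) hs1
      have h3 : (1 / 27) * D ^ s ≤ (a : ℝ) ^ (2 / (3 * ℓ) * (1 - δ)) := by
        calc (1 / 27) * D ^ s ≤ (1 / 27 : ℝ) ^ s * D ^ s := by gcongr
          _ = (1 / 27 * D) ^ s := (Real.mul_rpow (by norm_num) hD0.le).symm
          _ ≤ ((a : ℝ) ^ 2) ^ s := by
            gcongr
            linarith
          _ = (a : ℝ) ^ (2 / (3 * ℓ) * (1 - δ)) := by
            rw [← Real.rpow_natCast_mul (Nat.cast_nonneg a), hs]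
            congr 1
            push_cast
            ring
      linarith
    have h4 : 0 < D ^ s := by positivity
    have h5 := (mul_le_mul_of_nonneg_left (h1.trans hN) (Nat.cast_nonneg _)).trans h
    have h6 : (Nat.card {c : ClassGroup (𝓞 K) // c ^ ℓ = 1} : ℝ) ≤
        648 * C₁ * D ^ (1 / 2 + ε / 2 - s) := by
      rw [Real.rpow_sub hD0, ← mul_div_assoc, le_div_iff₀ h4]
      linarith
    refine h6.trans ?_
    gcongr
    · have : 0 ≤ C₁ * (27 * (a₀ : ℝ) ^ 2 + 1) ^ (1 / 2 + ε / 2) := by positivity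
      linarith
    · have : 1 / (3 * (ℓ : ℝ)) * δ ≤ 1 / 3 * ε := by gcongr
      rw [hs]
      linarith
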